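/- arXiv:2304.05704 — 7 statements merged into one kernel-verified Lean document; each statement's English description precedes it below -/
import Mathlib

section
/- Let ρ be a density matrix on ℂ^n and let X = {X_x} and Y = {Y_y} be arbitrary discrete POVMs on ℂ^n. Then the Shannon entropies satisfy H(X|ρ) + H(Y|ρ) ≥ −log μ_XY, where μ_XY := max_{x,y} λ_max(X_x^{1/2} Y_y X_x^{1/2}); moreover μ_XY = μ_YX. -/
noncomputable section
open scoped BigOperators Classical ComplexOrder
open Matrix

namespace QC

/-- A density matrix: positive semidefinite with unit trace. -/
def IsDensity {m : Type*} [Fintype m] [DecidableEq m] (ρ : Matrix m m ℂ) : Prop :=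
  ρ.PosSemidef ∧ ρ.trace = 1

/-- A (discrete) POVM: positive semidefinite elements summing to the identity. -/
def IsPOVM {m ι : Type*} [Fintype m] [DecidableEq m] [Fintype ι]
    (X : ι → Matrix m m ℂ) : Prop :=
  (∀ x, (X x).PosSemidef) ∧ ∑ x, X x = 1

/-- A projective observable: mutually orthogonal Hermitian projections. -/
def IsProjective {m ι : Type*} [Fintype m] [DecidableEq m] [Fintype ι]
    (X : ι → Matrix m m ℂ) : Prop :=
  (∀ x, (X x).IsHermitian) ∧ ∀ x x', X x * X x' = if x = x' then X x else 0

/-- Eigenvalues of a matrix (junk value `0` if not Hermitian). -/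
noncomputable def eigs {m : Type*} [Fintype m] [DecidableEq m] (A : Matrix m m ℂ) : m → ℝ :=
  if h : A.IsHermitian then h.eigenvalues else 0

/-- Largest eigenvalue of a Hermitian matrix. -/
noncomputable def lamMax {m : Type*} [Fintype m] [DecidableEq m] (A : Matrix m m ℂ) : ℝ :=
  ⨆ i, eigs A i

/-- Real power of a Hermitian matrix, taken on its support (junk value `0` if not Hermitian).
Since `(0:ℝ) ^ r = 0` for `r ≠ 0`, the power is taken on the support. -/
noncomputable def mpow {m : Type*} [Fintype m] [DecidableEq m]
    (A : Matrix m m ℂ) (r : ℝ) : Matrix m m ℂ :=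
  if h : A.IsHermitian then
    (h.eigenvectorUnitary : Matrix m m ℂ) *
      Matrix.diagonal (fun i => ((h.eigenvalues i ^ r : ℝ) : ℂ)) *
      (star (h.eigenvectorUnitary : Matrix m m ℂ))
  else 0

/-- Logarithm of a Hermitian matrix, taken on its support. -/
noncomputable def mlog {m : Type*} [Fintype m] [DecidableEq m]
    (A : Matrix m m ℂ) : Matrix m m ℂ :=
  if h : A.IsHermitian then
    (h.eigenvectorUnitary : Matrix m m ℂ) *
      Matrix.diagonal (fun i => ((Real.log (h.eigenvalues i) : ℝ) : ℂ)) *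
      (star (h.eigenvectorUnitary : Matrix m m ℂ))
  else 0

/-- Support inclusion of matrices (as linear maps). -/
def suppLE {m : Type*} [Fintype m] [DecidableEq m] (ρ σ : Matrix m m ℂ) : Prop :=
  LinearMap.range (Matrix.toLin' ρ) ≤ LinearMap.range (Matrix.toLin' σ)

/-- Quantum relative entropy `Tr[ρ (log ρ - log σ)]` (finite part). -/
noncomputable def relEnt {m : Type*} [Fintype m] [DecidableEq m]
    (ρ σ : Matrix m m ℂ) : ℝ :=
  ((ρ * (mlog ρ - mlog σ)).trace).re

/-- `Tr[(σ^{(1-α)/(2α)} ρ σ^{(1-α)/(2α)})^α]`, computed via eigenvalues. -/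
noncomputable def sandTr {m : Type*} [Fintype m] [DecidableEq m]
    (α : ℝ) (ρ σ : Matrix m m ℂ) : ℝ :=
  ∑ i, (eigs (mpow σ ((1 - α) / (2 * α)) * ρ * mpow σ ((1 - α) / (2 * α))) i) ^ α

/-- Sandwiched Rényi divergence, `+∞` when `α ≥ 1` and the support of `ρ` is not
contained in that of `σ`; `D_1` is the quantum relative entropy. -/
noncomputable def Dren {m : Type*} [Fintype m] [DecidableEq m]
    (α : ℝ) (ρ σ : Matrix m m ℂ) : EReal :=
  if 1 ≤ α ∧ ¬ suppLE ρ σ then ⊤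
  else if α = 1 then ((relEnt ρ σ : ℝ) : EReal)
  else (((α - 1)⁻¹ * Real.log (sandTr α ρ σ) : ℝ) : EReal)

/-- Outcome distribution `p(x|ρ) = Tr(ρ X_x)`. -/
noncomputable def probOf {m ι : Type*} [Fintype m] [DecidableEq m]
    (ρ : Matrix m m ℂ) (X : ι → Matrix m m ℂ) (x : ι) : ℝ :=
  ((ρ * X x).trace).re

/-- Rényi entropy of a distribution (`α = 1` gives the Shannon entropy). -/
noncomputable def renyiH {ι : Type*} [Fintype ι] (α : ℝ) (p : ι → ℝ) : ℝ :=
  if α = 1 then ∑ x, Real.negMulLog (p x)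
  else (1 - α)⁻¹ * Real.log (∑ x, (p x) ^ α)

/-- Pinching `σ_X := Σ_x X_x σ X_x`. -/
noncomputable def pinch {m ι : Type*} [Fintype m] [DecidableEq m] [Fintype ι]
    (X : ι → Matrix m m ℂ) (σ : Matrix m m ℂ) : Matrix m m ℂ :=
  ∑ x, X x * σ * X x

/-- Rényi asymmetry of a projective observable:
`Q_α(X|ρ) = inf_σ D_α(ρ ‖ σ_X)` over density matrices `σ`. -/
noncomputable def Qproj {n : ℕ} {ι : Type*} [Fintype ι]
    (α : ℝ) (X : ι → Matrix (Fin n) (Fin n) ℂ) (ρ : Matrix (Fin n) (Fin n) ℂ) : EReal :=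
  ⨅ σ : {σ : Matrix (Fin n) (Fin n) ℂ // IsDensity σ}, Dren α ρ (pinch X σ.1)

/-- von Neumann entropy `H(ρ) = -Tr[ρ log ρ]`. -/
noncomputable def vnEnt {m : Type*} [Fintype m] [DecidableEq m] (ρ : Matrix m m ℂ) : ℝ :=
  - ((ρ * mlog ρ).trace).re

/-- A Naimark extension of a POVM `X` on `ℂ^n`: an isometry `V : ℂ^n → ℂ^m` together with a
projective observable `X̃` on `ℂ^m` with `X_x = V† X̃_x V` (i.e. `X_x = P X̃_x P` under the
identification of `ℂ^n` with its image). -/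
structure Naimark (n m : ℕ) {ι : Type*} [Fintype ι]
    (X : ι → Matrix (Fin n) (Fin n) ℂ) where
  V : Matrix (Fin m) (Fin n) ℂ
  isometry : Vᴴ * V = 1
  Xt : ι → Matrix (Fin m) (Fin m) ℂ
  projective : IsProjective Xt
  sum_eq : ∑ x, Xt x = 1
  compat : ∀ x, X x = Vᴴ * Xt x * V

/-- Rényi asymmetry of an arbitrary discrete observable relative to a fixed Naimark
extension: `Q_α(X|ρ) = inf_σ D_α(ρ ‖ σ_X̃)` over density matrices `σ` on `ℂ^n`
(regarded as matrices on `ℂ^m`). -/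
noncomputable def Qnaimark {n m : ℕ} {ι : Type*} [Fintype ι]
    {X : ι → Matrix (Fin n) (Fin n) ℂ} (α : ℝ) (E : Naimark n m X)
    (ρ : Matrix (Fin n) (Fin n) ℂ) : EReal :=
  ⨅ σ : {σ : Matrix (Fin n) (Fin n) ℂ // IsDensity σ},
    Dren α (E.V * ρ * E.Vᴴ) (pinch E.Xt (E.V * σ.1 * E.Vᴴ))


/-- Cauchy–Schwarz for the semi-inner product `⟨P, Q⟩ = Tr (ρ Pᴴ Q)`. -/
lemma norm_trace_sq_le {m : Type*} [Fintype m] {ρ : Matrix m m ℂ}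
    (hρ : ρ.PosSemidef) (P Q : Matrix m m ℂ) :
    ‖(ρ * (Pᴴ * Q)).trace‖ ^ 2 ≤
      ((ρ * (Pᴴ * P)).trace).re * ((ρ * (Qᴴ * Q)).trace).re := by
  let := ρ.toMatrixSeminormedAddCommGroup hρ
  let := ρ.toMatrixInnerProductSpace hρ
  have key : ∀ A B : Matrix m m ℂ, inner ℂ A B = (ρ * (Aᴴ * B)).trace := fun A B => by
    rw [← Matrix.mul_assoc, Matrix.trace_mul_comm, ← Matrix.mul_assoc]
    rfl
  have h := norm_inner_le_norm (𝕜 := ℂ) P Q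
  rw [← key, ← key, ← key]
  have hP := norm_sq_eq_re_inner (𝕜 := ℂ) P
  have hQ := norm_sq_eq_re_inner (𝕜 := ℂ) Q
  simp only [RCLike.re_eq_complex_re] at hP hQ
  rw [← hP, ← hQ, ← mul_pow]
  exact pow_le_pow_left₀ (norm_nonneg _) h 2

section Matrices

variable {m : Type*} [Fintype m] [DecidableEq m]

lemma mpow_isHermitian {A : Matrix m m ℂ} (hA : A.IsHermitian) (r : ℝ) :
    (mpow A r).IsHermitian := by
  rw [mpow, dif_pos hA, Matrix.star_eq_conjTranspose]
  exact Matrix.isHermitian_mul_mul_conjTranspose _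
    (Matrix.isHermitian_diagonal_of_self_adjoint _ (by ext i; simp))

lemma eigenvectorUnitary_diagonal {A : Matrix m m ℂ} (hA : A.IsHermitian) :
    (hA.eigenvectorUnitary : Matrix m m ℂ) *
      Matrix.diagonal (fun i => (hA.eigenvalues i : ℂ)) *
      star (hA.eigenvectorUnitary : Matrix m m ℂ) = A := by
  conv_rhs => rw [hA.spectral_theorem, Unitary.conjStarAlgAut_apply]
  rfl

lemma mpow_half_mul_self {A : Matrix m m ℂ} (hA : A.PosSemidef) :
    mpow A (1 / 2) * mpow A (1 / 2) = A := by
  have hU : star (hA.isHermitian.eigenvectorUnitary : Matrix m m ℂ) *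
      (hA.isHermitian.eigenvectorUnitary : Matrix m m ℂ) = 1 :=
    Unitary.coe_star_mul_self _
  conv_rhs => rw [← eigenvectorUnitary_diagonal hA.isHermitian]
  rw [mpow, dif_pos hA.isHermitian]
  set U := (hA.isHermitian.eigenvectorUnitary : Matrix m m ℂ)
  set D := Matrix.diagonal
    (fun i => ((hA.isHermitian.eigenvalues i ^ (1 / 2 : ℝ) : ℝ) : ℂ)) with hD
  have hDD : D * D = Matrix.diagonal (fun i => (hA.isHermitian.eigenvalues i : ℂ)) := by
    rw [hD, Matrix.diagonal_mul_diagonal]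
    congr 1
    ext i
    rw [← Complex.ofReal_mul, ← Real.sqrt_eq_rpow,
      Real.mul_self_sqrt (hA.eigenvalues_nonneg i)]
  calc U * D * star U * (U * D * star U) = U * D * (star U * U) * D * star U := by
        simp only [Matrix.mul_assoc]
    _ = U * (D * D) * star U := by rw [hU]; simp only [Matrix.mul_assoc, Matrix.one_mul]
    _ = _ := by rw [hDD]

lemma trace_mul_re_nonneg {ρ M : Matrix m m ℂ} (hρ : ρ.PosSemidef) (hM : M.PosSemidef) :
    0 ≤ ((ρ * M).trace).re := by
  have h := (hρ.mul_mul_conjTranspose_same (mpow M (1 / 2))).trace_nonneg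
  rw [Matrix.trace_mul_cycle, (mpow_isHermitian hM.isHermitian _).eq, mpow_half_mul_self hM,
    Matrix.trace_mul_comm] at h
  exact (Complex.nonneg_iff.mp h).1

lemma lamMax_smul_one_sub_posSemidef {A : Matrix m m ℂ} (hA : A.IsHermitian) :
    ((lamMax A : ℂ) • (1 : Matrix m m ℂ) - A).PosSemidef := by
  have hU : (hA.eigenvectorUnitary : Matrix m m ℂ) *
      star (hA.eigenvectorUnitary : Matrix m m ℂ) = 1 :=
    Unitary.coe_mul_star_self _
  have hle : ∀ i, hA.eigenvalues i ≤ lamMax A := fun i => by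
    have : lamMax A = ⨆ i, hA.eigenvalues i := by simp only [lamMax, eigs, dif_pos hA]
    rw [this]
    exact le_ciSup (Set.finite_range _).bddAbove i
  have hD : (Matrix.diagonal
      (fun i => ((lamMax A - hA.eigenvalues i : ℝ) : ℂ)) : Matrix m m ℂ).PosSemidef :=
    Matrix.PosSemidef.diagonal fun i => by
      simpa using hle i
  have h := hD.mul_mul_conjTranspose_same (hA.eigenvectorUnitary : Matrix m m ℂ)
  convert h using 1
  have hdiag : (Matrix.diagonal (fun i => ((lamMax A - hA.eigenvalues i : ℝ) : ℂ)) :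
      Matrix m m ℂ) = (lamMax A : ℂ) • (1 : Matrix m m ℂ) -
        Matrix.diagonal (fun i => (hA.eigenvalues i : ℂ)) := by
    rw [← Matrix.diagonal_one, ← Matrix.diagonal_smul, Matrix.diagonal_sub]
    congr 1
    ext i
    simp
  rw [hdiag, Matrix.mul_sub, Matrix.sub_mul, ← Matrix.star_eq_conjTranspose,
    eigenvectorUnitary_diagonal hA, Matrix.mul_smul, Matrix.smul_mul, Matrix.mul_one, hU]

/-- Conjugating either of two positive semidefinite matrices by the square root of the other
gives the same largest eigenvalue. -/
lemma lamMax_mpow_half_comm {A B : Matrix m m ℂ} (hA : A.PosSemidef) (hB : B.PosSemidef) :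
    lamMax (mpow A (1 / 2) * B * mpow A (1 / 2)) =
      lamMax (mpow B (1 / 2) * A * mpow B (1 / 2)) := by
  have h₁ : (mpow A (1 / 2) * B * mpow A (1 / 2)).IsHermitian := by
    have := Matrix.isHermitian_mul_mul_conjTranspose (mpow A (1 / 2)) hB.isHermitian
    rwa [(mpow_isHermitian hA.isHermitian _).eq] at this
  have h₂ : (mpow B (1 / 2) * A * mpow B (1 / 2)).IsHermitian := by
    have := Matrix.isHermitian_mul_mul_conjTranspose (mpow B (1 / 2)) hA.isHermitian
    rwa [(mpow_isHermitian hB.isHermitian _).eq] at this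
  have hchar : (mpow A (1 / 2) * B * mpow A (1 / 2)).charpoly =
      (mpow B (1 / 2) * A * mpow B (1 / 2)).charpoly := by
    rw [Matrix.mul_assoc, Matrix.charpoly_mul_comm, Matrix.mul_assoc, mpow_half_mul_self hA,
      Matrix.mul_assoc (mpow B (1 / 2)), Matrix.charpoly_mul_comm (mpow B (1 / 2)),
      Matrix.mul_assoc, mpow_half_mul_self hB, Matrix.charpoly_mul_comm]
  simp only [lamMax, eigs, dif_pos h₁, dif_pos h₂,
    (Matrix.IsHermitian.eigenvalues_eq_eigenvalues_iff h₁ h₂).mpr hchar]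

lemma norm_trace_mul_sq_le_of_posSemidef {ρ S T : Matrix m m ℂ} {c : ℝ} (hρ : ρ.PosSemidef)
    (hS : S.IsHermitian) (hT : T.IsHermitian)
    (hpos : ((c : ℂ) • (1 : Matrix m m ℂ) - S * (T * T) * S).PosSemidef) :
    ‖(ρ * ((T * T) * (S * S))).trace‖ ^ 2 ≤
      ((ρ * (T * T)).trace).re * (c * ((ρ * (S * S)).trace).re) := by
  have hcs := norm_trace_sq_le hρ T (T * (S * S))
  have e : (T * (S * S))ᴴ * (T * (S * S)) = S * (S * (T * T) * S) * S := by
    rw [Matrix.conjTranspose_mul, Matrix.conjTranspose_mul, hT.eq, hS.eq]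
    simp only [Matrix.mul_assoc]
  rw [e, hT.eq, ← Matrix.mul_assoc T T (S * S)] at hcs
  have hconj := hpos.mul_mul_conjTranspose_same S
  rw [hS.eq, Matrix.mul_sub, Matrix.sub_mul, Matrix.mul_smul, Matrix.smul_mul,
    Matrix.mul_one] at hconj
  have hle := trace_mul_re_nonneg hρ hconj
  rw [Matrix.mul_sub, Matrix.trace_sub, Matrix.mul_smul, Matrix.trace_smul, Complex.sub_re,
    smul_eq_mul, Complex.re_ofReal_mul] at hle
  have hnn : 0 ≤ ((ρ * (T * T)).trace).re := by
    have := trace_mul_re_nonneg hρ (Matrix.posSemidef_conjTranspose_mul_self T)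
    rwa [hT.eq] at this
  exact hcs.trans (mul_le_mul_of_nonneg_left (by linarith) hnn)

lemma norm_trace_mul_sq_le {ρ A B : Matrix m m ℂ} (hρ : ρ.PosSemidef) (hA : A.PosSemidef)
    (hB : B.PosSemidef) :
    ‖(ρ * (B * A)).trace‖ ^ 2 ≤
      ((ρ * B).trace).re *
        (lamMax (mpow A (1 / 2) * B * mpow A (1 / 2)) * ((ρ * A).trace).re) := by
  have hS := mpow_isHermitian hA.isHermitian (1 / 2)
  have h₁ : (mpow A (1 / 2) * B * mpow A (1 / 2)).IsHermitian := by
    have := Matrix.isHermitian_mul_mul_conjTranspose (mpow A (1 / 2)) hB.isHermitian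
    rwa [hS.eq] at this
  have hpos := lamMax_smul_one_sub_posSemidef h₁
  have h := norm_trace_mul_sq_le_of_posSemidef (T := mpow B (1 / 2))
    (c := lamMax (mpow A (1 / 2) * B * mpow A (1 / 2))) hρ hS
    (mpow_isHermitian hB.isHermitian (1 / 2)) (by rwa [mpow_half_mul_self hB])
  rwa [mpow_half_mul_self hA, mpow_half_mul_self hB] at h

variable {ι : Type*} [Fintype ι]

/-- A combination of POVM elements with unimodular coefficients is a contraction. -/
lemma one_sub_conjTranspose_mul_self_posSemidef {X : ι → Matrix m m ℂ} (hX : IsPOVM X)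
    {u : ι → ℂ} (hu : ∀ x, ‖u x‖ = 1) :
    (1 - (∑ x, u x • X x)ᴴ * (∑ x, u x • X x)).PosSemidef := by
  set V := ∑ x, u x • X x with hV
  have hVH : Vᴴ = ∑ x, star (u x) • X x := by
    rw [hV, Matrix.conjTranspose_sum]
    exact Finset.sum_congr rfl fun x _ => by
      rw [Matrix.conjTranspose_smul, (hX.1 x).isHermitian.eq]
  have hterm : ∀ x, ((u x • (1 : Matrix m m ℂ) - V)ᴴ * X x * (u x • 1 - V)) =
      X x - (star (u x) • X x) * V - Vᴴ * (u x • X x) + Vᴴ * X x * V := fun x => by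
    have h1 : star (u x) * u x = 1 := by
      rw [Complex.star_def, ← Complex.normSq_eq_conj_mul_self, Complex.normSq_eq_norm_sq, hu x]
      simp
    rw [Matrix.conjTranspose_sub, Matrix.conjTranspose_smul, Matrix.conjTranspose_one,
      Matrix.sub_mul, Matrix.mul_sub, Matrix.sub_mul, Matrix.sub_mul]
    simp only [Matrix.smul_mul, Matrix.mul_smul, Matrix.one_mul, Matrix.mul_one, smul_smul,
      mul_comm (u x), h1, one_smul]
    abel
  have hsum : ∑ x, ((u x • (1 : Matrix m m ℂ) - V)ᴴ * X x * (u x • 1 - V)) = 1 - Vᴴ * V := by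
    simp only [hterm, Finset.sum_add_distrib, Finset.sum_sub_distrib, ← Finset.sum_mul,
      ← Finset.mul_sum, hX.2, ← hVH, ← hV, Matrix.mul_one]
    abel
  rw [← hsum]
  exact Matrix.posSemidef_sum _ fun x _ => (hX.1 x).conjTranspose_mul_mul_same _

lemma trace_conjTranspose_mul_self_re_le_one {ρ : Matrix m m ℂ} (hρ : IsDensity ρ)
    {X : ι → Matrix m m ℂ} (hX : IsPOVM X) {u : ι → ℂ} (hu : ∀ x, ‖u x‖ = 1) :
    ((ρ * ((∑ x, u x • X x)ᴴ * (∑ x, u x • X x))).trace).re ≤ 1 := by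
  have h := trace_mul_re_nonneg hρ.1 (one_sub_conjTranspose_mul_self_posSemidef hX hu)
  rw [Matrix.mul_sub, Matrix.trace_sub, Matrix.mul_one, hρ.2, Complex.sub_re, Complex.one_re] at h
  linarith

variable {κ : Type*} [Fintype κ]

lemma norm_trace_unimodular_le_one {ρ : Matrix m m ℂ} (hρ : IsDensity ρ)
    {X : ι → Matrix m m ℂ} (hX : IsPOVM X) {Y : κ → Matrix m m ℂ} (hY : IsPOVM Y)
    {u : ι → ℂ} (hu : ∀ x, ‖u x‖ = 1) {v : κ → ℂ} (hv : ∀ y, ‖v y‖ = 1) :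
    ‖(ρ * ((∑ y, v y • Y y) * ∑ x, u x • X x)).trace‖ ≤ 1 := by
  have hW : (∑ y, star (v y) • Y y)ᴴ = ∑ y, v y • Y y := by
    rw [Matrix.conjTranspose_sum]
    exact Finset.sum_congr rfl fun y _ => by
      rw [Matrix.conjTranspose_smul, (hY.1 y).isHermitian.eq, star_star]
  have h := norm_trace_sq_le hρ.1 (∑ y, star (v y) • Y y) (∑ x, u x • X x)
  have h₁ := trace_conjTranspose_mul_self_re_le_one hρ hX hu
  have h₂ := trace_conjTranspose_mul_self_re_le_one hρ hY (u := fun y => star (v y))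
    (fun y => by rw [norm_star, hv])
  have h₃ := trace_mul_re_nonneg hρ.1
    (Matrix.posSemidef_conjTranspose_mul_self (∑ x, u x • X x))
  rw [hW] at h h₂
  exact (sq_le_one_iff₀ (norm_nonneg _)).mp (h.trans (mul_le_one₀ h₂ h₃ h₁))

end Matrices

lemma deriv_le_of_le_on_unit_interval {g h : ℝ → ℝ} {g' h' : ℝ} (hg : HasDerivAt g g' 0)
    (hh : HasDerivAt h h' 0) (h0 : g 0 = h 0) (hle : ∀ t, 0 < t → t < 1 → g t ≤ h t) :
    g' ≤ h' := by
  have ht := (hh.sub hg).tendsto_slope_zero_right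
  refine sub_nonneg.mp (ge_of_tendsto ht ?_)
  filter_upwards [Ioo_mem_nhdsGT (zero_lt_one (α := ℝ))] with t ht
  have := hle t ht.1 ht.2
  simp only [zero_add, Pi.sub_apply, h0, sub_self, sub_zero, smul_eq_mul]
  exact mul_nonneg (inv_nonneg.mpr ht.1.le) (by linarith)

/-- Derivative at the boundary of Hadamard's three lines theorem for exponential sums. -/
lemma sum_mul_re_le_log_of_three_lines {ι : Type*} [Fintype ι] (L : ι → ℝ) (a : ι → ℂ) {b : ℝ}
    (hb : 0 < b) (hsum : ∑ i, a i = 1)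
    (h0 : ∀ z : ℂ, z.re = 0 → ‖∑ i, Complex.exp (z * L i) * a i‖ ≤ 1)
    (h1 : ∀ z : ℂ, z.re = 1 → ‖∑ i, Complex.exp (z * L i) * a i‖ ≤ b) :
    ∑ i, L i * (a i).re ≤ Real.log b := by
  have hd : Differentiable ℂ fun z : ℂ => ∑ i, Complex.exp (z * L i) * a i := by fun_prop
  have hB : BddAbove ((norm ∘ fun z : ℂ => ∑ i, Complex.exp (z * L i) * a i) ''
      Complex.HadamardThreeLines.verticalClosedStrip 0 1) := by
    refine ⟨∑ i, Real.exp |L i| * ‖a i‖, ?_⟩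
    rintro _ ⟨z, hz, rfl⟩
    refine (norm_sum_le _ _).trans (Finset.sum_le_sum fun i _ => ?_)
    rw [norm_mul, Complex.norm_exp, Complex.re_mul_ofReal]
    have hz' : 0 ≤ z.re ∧ z.re ≤ 1 := hz
    gcongr
    calc z.re * L i ≤ z.re * |L i| := mul_le_mul_of_nonneg_left (le_abs_self _) hz'.1
      _ ≤ 1 * |L i| := mul_le_mul_of_nonneg_right hz'.2 (abs_nonneg _)
      _ = |L i| := one_mul _
  have hbound : ∀ t : ℝ, 0 < t → t < 1 →
      ∑ i, Real.exp (t * L i) * (a i).re ≤ Real.exp (t * Real.log b) := fun t ht0 ht1 => by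
    have := Complex.HadamardThreeLines.norm_le_interp_of_mem_verticalClosedStrip₀₁'
      (fun z : ℂ => ∑ i, Complex.exp (z * L i) * a i) (z := (t : ℂ)) (a := 1) (b := b)
      (by simp [Complex.HadamardThreeLines.verticalClosedStrip, ht0.le, ht1.le])
      hd.diffContOnCl hB (fun z hz => h0 z hz) (fun z hz => h1 z hz)
    rw [Real.one_rpow, one_mul, Complex.ofReal_re, Real.rpow_def_of_pos hb,
      mul_comm (Real.log b)] at this
    refine le_trans (le_of_eq ?_) ((Complex.re_le_norm _).trans this)
    rw [Complex.re_sum]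
    refine Finset.sum_congr rfl fun i _ => ?_
    rw [← Complex.ofReal_mul, ← Complex.ofReal_exp, Complex.re_ofReal_mul]
  have hexp : ∀ k : ℝ, HasDerivAt (fun t : ℝ => Real.exp (t * k)) k 0 := fun k => by
    simpa using ((hasDerivAt_id (0 : ℝ)).mul_const k).exp
  refine deriv_le_of_le_on_unit_interval
    (HasDerivAt.fun_sum fun i _ => (hexp (L i)).mul_const (a i).re) (hexp (Real.log b)) ?_ hbound
  have := congrArg Complex.re hsum
  rw [Complex.re_sum] at this
  simpa using this

lemma ciSup_comm_of_finite {ι κ : Type*} [Finite ι] [Finite κ] [Nonempty ι] [Nonempty κ]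
    (f : ι → κ → ℝ) : ⨆ x, ⨆ y, f x y = ⨆ y, ⨆ x, f x y := by
  apply le_antisymm
  · exact ciSup_le fun x => ciSup_le fun y =>
      (le_ciSup (f := fun x => f x y) (Set.finite_range _).bddAbove x).trans
        (le_ciSup (f := fun y => ⨆ x, f x y) (Set.finite_range _).bddAbove y)
  · exact ciSup_le fun y => ciSup_le fun x =>
      (le_ciSup (f := fun y => f x y) (Set.finite_range _).bddAbove y).trans
        (le_ciSup (f := fun x => ⨆ y, f x y) (Set.finite_range _).bddAbove x)

lemma IsPOVM.nonempty {m ι : Type*} [Fintype m] [DecidableEq m] [Fintype ι] [Nonempty m]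
    {X : ι → Matrix m m ℂ} (hX : IsPOVM X) : Nonempty ι := by
  by_contra h
  rw [not_nonempty_iff] at h
  have := hX.2
  simp at this

/-- Entropic uncertainty relation for Shannon entropies of two arbitrary
POVMs: `H(X|ρ) + H(Y|ρ) ≥ -log μ_XY`, where
`μ_XY = max_{x,y} λ_max(X_x^{1/2} Y_y X_x^{1/2})`; moreover `μ_XY = μ_YX`. -/
theorem shannon_entropic_uncertainty
    {n : ℕ} {ι κ : Type*} [Fintype ι] [Fintype κ]
    (ρ : Matrix (Fin n) (Fin n) ℂ) (hρ : IsDensity ρ)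
    (X : ι → Matrix (Fin n) (Fin n) ℂ) (hX : IsPOVM X)
    (Y : κ → Matrix (Fin n) (Fin n) ℂ) (hY : IsPOVM Y) :
    (- Real.log (⨆ x, ⨆ y, lamMax (mpow (X x) (1/2) * Y y * mpow (X x) (1/2)))
      ≤ (∑ x, Real.negMulLog (probOf ρ X x)) + ∑ y, Real.negMulLog (probOf ρ Y y)) ∧
    (⨆ x, ⨆ y, lamMax (mpow (X x) (1/2) * Y y * mpow (X x) (1/2)))
      = (⨆ y, ⨆ x, lamMax (mpow (Y y) (1/2) * X x * mpow (Y y) (1/2))) := by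
  have hn : Nonempty (Fin n) := by
    by_contra h
    rw [not_nonempty_iff] at h
    have := hρ.2
    simp [Matrix.trace] at this
  have hι := hX.nonempty
  have hκ := hY.nonempty
  refine ⟨?_, ?_⟩
  swap
  · rw [ciSup_comm_of_finite]
    simp only [fun x y => lamMax_mpow_half_comm (hX.1 x) (hY.1 y)]
  set c := ⨆ x, ⨆ y, lamMax (mpow (X x) (1/2) * Y y * mpow (X x) (1/2))
  have hlec : ∀ x y, lamMax (mpow (X x) (1/2) * Y y * mpow (X x) (1/2)) ≤ c := fun x y =>
    (le_ciSup (f := fun y => lamMax (mpow (X x) (1/2) * Y y * mpow (X x) (1/2)))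
      (Set.finite_range _).bddAbove y).trans
      (le_ciSup (f := fun x => ⨆ y, lamMax (mpow (X x) (1/2) * Y y * mpow (X x) (1/2)))
        (Set.finite_range _).bddAbove x)
  have hp : ∀ x, 0 ≤ probOf ρ X x := fun x => trace_mul_re_nonneg hρ.1 (hX.1 x)
  have hq : ∀ y, 0 ≤ probOf ρ Y y := fun y => trace_mul_re_nonneg hρ.1 (hY.1 y)
  set p := probOf ρ X with hpdef
  set q := probOf ρ Y with hqdef
  have hpsum : ∑ x, p x = 1 := by
    simp only [hpdef, probOf]
    rw [← Complex.re_sum, ← Matrix.trace_sum, ← Finset.mul_sum, hX.2, Matrix.mul_one, hρ.2,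
      Complex.one_re]
  have hqsum : ∑ y, q y = 1 := by
    simp only [hqdef, probOf]
    rw [← Complex.re_sum, ← Matrix.trace_sum, ← Finset.mul_sum, hY.2, Matrix.mul_one, hρ.2,
      Complex.one_re]
  have hm : ∀ x y, ‖(ρ * (Y y * X x)).trace‖ ^ 2 ≤ c * (p x * q y) := fun x y => by
    refine (norm_trace_mul_sq_le hρ.1 (hX.1 x) (hY.1 y)).trans ?_
    change q y * (_ * p x) ≤ _
    have := mul_le_mul_of_nonneg_right (hlec x y) (mul_nonneg (hp x) (hq y))
    linarith
  have hsumX : ∀ y, ∑ x, (ρ * (Y y * X x)).trace = (ρ * Y y).trace := fun y => by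
    rw [← Matrix.trace_sum, ← Finset.mul_sum, ← Finset.mul_sum, hX.2, Matrix.mul_one]
  have hsumY : ∀ x, ∑ y, (ρ * (Y y * X x)).trace = (ρ * X x).trace := fun x => by
    rw [← Matrix.trace_sum, ← Finset.mul_sum, ← Finset.sum_mul, hY.2, Matrix.one_mul]
  have hsum : ∑ i : ι × κ, (ρ * (Y i.2 * X i.1)).trace = 1 := by
    rw [Fintype.sum_prod_type]
    simp only [hsumY]
    rw [← Matrix.trace_sum, ← Finset.mul_sum, hX.2, Matrix.mul_one, hρ.2]
  have hc0 : 0 < c := by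
    by_contra hneg
    have hz : ∀ i : ι × κ, (ρ * (Y i.2 * X i.1)).trace = 0 := fun i => by
      have h := (hm i.1 i.2).trans
        (mul_nonpos_of_nonpos_of_nonneg (not_lt.mp hneg) (mul_nonneg (hp i.1) (hq i.2)))
      exact norm_eq_zero.mp (pow_eq_zero_iff two_ne_zero |>.mp (le_antisymm h (sq_nonneg _)))
    simp [hz] at hsum
  have hpq : ∀ x y, Real.exp ((Real.log (p x) + Real.log (q y)) / 2) *
      ‖(ρ * (Y y * X x)).trace‖ ≤ √c * (p x * q y) := fun x y => by
    have h := hm x y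
    rcases (mul_nonneg (hp x) (hq y)).eq_or_lt with h0 | hpos
    · rw [← h0, mul_zero] at h
      have hz := pow_eq_zero_iff two_ne_zero |>.mp (le_antisymm h (sq_nonneg _))
      rw [hz, ← h0, mul_zero, mul_zero]
    · have hpx : p x ≠ 0 := left_ne_zero_of_mul hpos.ne'
      have hqy : q y ≠ 0 := right_ne_zero_of_mul hpos.ne'
      rw [← Real.log_mul hpx hqy, ← Real.log_sqrt hpos.le, Real.exp_log (Real.sqrt_pos.mpr hpos)]
      have h2 := Real.le_sqrt_of_sq_le h
      rw [Real.sqrt_mul hc0.le] at h2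
      calc √(p x * q y) * ‖(ρ * (Y y * X x)).trace‖
          ≤ √(p x * q y) * (√c * √(p x * q y)) :=
            mul_le_mul_of_nonneg_left h2 (Real.sqrt_nonneg _)
        _ = √c * (√(p x * q y) * √(p x * q y)) := by ring
        _ = √c * (p x * q y) := by rw [Real.mul_self_sqrt hpos.le]
  have key := sum_mul_re_le_log_of_three_lines
    (fun i : ι × κ => (Real.log (p i.1) + Real.log (q i.2)) / 2)
    (fun i => (ρ * (Y i.2 * X i.1)).trace) (Real.sqrt_pos.mpr hc0) hsum ?_ ?_
  · rw [Real.log_sqrt hc0.le] at key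
    have e : ∑ i : ι × κ, (Real.log (p i.1) + Real.log (q i.2)) / 2 *
        ((ρ * (Y i.2 * X i.1)).trace).re =
        (∑ x, Real.log (p x) * p x + ∑ y, Real.log (q y) * q y) / 2 := by
      have e₁ : ∑ i : ι × κ, Real.log (p i.1) * ((ρ * (Y i.2 * X i.1)).trace).re =
          ∑ x, Real.log (p x) * p x := by
        rw [Fintype.sum_prod_type]
        refine Finset.sum_congr rfl fun x _ => ?_
        dsimp only
        rw [← Finset.mul_sum, ← Complex.re_sum, hsumY]
        rfl
      have e₂ : ∑ i : ι × κ, Real.log (q i.2) * ((ρ * (Y i.2 * X i.1)).trace).re =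
          ∑ y, Real.log (q y) * q y := by
        rw [Fintype.sum_prod_type_right]
        refine Finset.sum_congr rfl fun y _ => ?_
        dsimp only
        rw [← Finset.mul_sum, ← Complex.re_sum, hsumX]
        rfl
      rw [← e₁, ← e₂, ← Finset.sum_add_distrib, Finset.sum_div]
      exact Finset.sum_congr rfl fun i _ => by ring
    rw [e] at key
    have e₃ : ∀ t : ℝ, Real.negMulLog t = -(Real.log t * t) := fun t => by
      rw [Real.negMulLog]; ring
    simp only [e₃, Finset.sum_neg_distrib]
    linarith
  · intro z hz
    have hnorm : ∀ r : ℝ, ‖Complex.exp (z * (r : ℂ))‖ = 1 := fun r => by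
      rw [Complex.norm_exp, Complex.re_mul_ofReal, hz, zero_mul, Real.exp_zero]
    have h := norm_trace_unimodular_le_one hρ hX hY
      (u := fun x => Complex.exp (z * ((Real.log (p x) / 2 : ℝ) : ℂ))) (fun x => hnorm _)
      (v := fun y => Complex.exp (z * ((Real.log (q y) / 2 : ℝ) : ℂ))) (fun y => hnorm _)
    convert h using 2
    simp only [Fintype.sum_prod_type, Finset.sum_mul, Finset.mul_sum, Matrix.trace_sum]
    refine Finset.sum_congr rfl fun x _ => Finset.sum_congr rfl fun y _ => ?_
    rw [Matrix.smul_mul, Matrix.mul_smul, Matrix.mul_smul, Matrix.mul_smul, Matrix.trace_smul,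
      Matrix.trace_smul, smul_eq_mul, smul_eq_mul, ← mul_assoc (Complex.exp _), ← Complex.exp_add]
    congr 2
    push_cast
    ring
  · intro z hz
    calc ‖∑ i : ι × κ, Complex.exp (z * (((Real.log (p i.1) + Real.log (q i.2)) / 2 : ℝ) : ℂ)) *
          (ρ * (Y i.2 * X i.1)).trace‖
        ≤ ∑ i : ι × κ, √c * (p i.1 * q i.2) := by
          refine (norm_sum_le _ _).trans (Finset.sum_le_sum fun i _ => ?_)
          rw [norm_mul, Complex.norm_exp, Complex.re_mul_ofReal, hz, one_mul]
          exact hpq i.1 i.2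
      _ = √c := by
          rw [← Finset.mul_sum, Fintype.sum_prod_type]
          simp only [← Finset.mul_sum, hqsum, mul_one, hpsum]

end QC
end
end

section
/- Let ρ be a density matrix on ℂ^n, let X be a rank-1 discrete POVM on ℂ^n with elements X_x = |x⟩⟨x| (the vectors |x⟩ need not be normalized, but Σ_x |x⟩⟨x| = 𝟙), and let Y = {Y_y} be an arbitrary discrete POVM on ℂ^n. Then the Shannon entropies satisfy H(X|ρ) + H(Y|ρ) ≥ −log max_{x,y} ⟨x|Y_y|x⟩ + H(ρ), where H(ρ) = −Tr[ρ log ρ] is the von Neumann entropy of ρ. -/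
noncomputable section
open scoped BigOperators Classical ComplexOrder
open Matrix

namespace QC

open Complex.HadamardThreeLines in
/-- First-order form of the three lines theorem at the left edge of the strip, for a finite
sum of exponentials normalized to `1` at the origin. -/
theorem re_sum_mul_le_log_of_three_lines {K : Type*} [Fintype K] (w : K → ℂ) (θ : K → ℝ)
    {M : ℝ} (hM : 0 < M) (hw : ∑ k, w k = 1)
    (h0 : ∀ z : ℂ, z.re = 0 → ‖∑ k, w k * Complex.exp (z * θ k)‖ ≤ 1)
    (h1 : ∀ z : ℂ, z.re = 1 → ‖∑ k, w k * Complex.exp (z * θ k)‖ ≤ M) :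
    ∑ k, (w k).re * θ k ≤ Real.log M := by
  set F : ℂ → ℂ := fun z => ∑ k, w k * Complex.exp (z * θ k) with hF
  have hd : Differentiable ℂ F := by
    rw [hF]; fun_prop
  have hbdd : BddAbove ((norm ∘ F) '' verticalClosedStrip 0 1) := by
    refine ⟨∑ k, ‖w k‖ * Real.exp |θ k|, ?_⟩
    rintro _ ⟨z, hz, rfl⟩
    have hz' : 0 ≤ z.re ∧ z.re ≤ 1 := hz
    refine (norm_sum_le _ _).trans (Finset.sum_le_sum fun k _ => ?_)
    rw [norm_mul, Complex.norm_exp, Complex.re_mul_ofReal]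
    gcongr
    calc z.re * θ k ≤ z.re * |θ k| := by gcongr; exacts [hz'.1, le_abs_self _]
      _ ≤ 1 * |θ k| := by gcongr; exact hz'.2
      _ = |θ k| := one_mul _
  have key : ∀ s : ℝ, 0 ≤ s → s ≤ 1 →
      ∑ k, (w k).re * Real.exp (s * θ k) ≤ Real.exp (s * Real.log M) := by
    intro s hs0 hs1
    have h := norm_le_interp_of_mem_verticalClosedStrip₀₁' F (z := (s : ℂ)) (a := 1) (b := M)
      (show ((s : ℂ).re) ∈ Set.Icc (0 : ℝ) 1 by simp [hs0, hs1]) hd.diffContOnCl hbdd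
      (fun z hz => h0 z hz) (fun z hz => h1 z hz)
    rw [Complex.ofReal_re, Real.one_rpow, one_mul, Real.rpow_def_of_pos hM,
      mul_comm (Real.log M)] at h
    refine le_trans (le_of_eq ?_) ((Complex.re_le_norm _).trans h)
    simp only [hF, Complex.re_sum]
    refine Finset.sum_congr rfl fun k _ => ?_
    rw [← Complex.ofReal_mul, ← Complex.ofReal_exp, Complex.re_mul_ofReal]
  set g : ℝ → ℝ := fun s =>
    Real.exp (s * Real.log M) - ∑ k, (w k).re * Real.exp (s * θ k) with hg
  have hg0 : g 0 = 0 := by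
    have := congrArg Complex.re hw
    simp only [Complex.re_sum, Complex.one_re] at this
    simp [hg, this]
  have hderiv : HasDerivAt g (Real.log M - ∑ k, (w k).re * θ k) 0 := by
    have he : ∀ t : ℝ, HasDerivAt (fun s : ℝ => Real.exp (s * t)) t 0 := fun t => by
      simpa using ((hasDerivAt_id (0 : ℝ)).mul_const t).exp
    exact (he _).sub (HasDerivAt.fun_sum fun k _ => (he (θ k)).const_mul _)
  have hslope := (hasDerivWithinAt_iff_tendsto_slope' (s := Set.Ioi (0 : ℝ)) (by simp)).1
    hderiv.hasDerivWithinAt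
  have hnonneg : 0 ≤ Real.log M - ∑ k, (w k).re * θ k := by
    refine ge_of_tendsto hslope ?_
    filter_upwards [Ioc_mem_nhdsGT (zero_lt_one (α := ℝ))] with s hs
    rw [slope_def_field, hg0, sub_zero, sub_zero]
    exact div_nonneg (sub_nonneg.2 (key s hs.1.le hs.2)) hs.1.le
  linarith

theorem conjTranspose_mul_self_apply_self {m : Type*} [Fintype m] (A : Matrix m m ℂ) (i : m) :
    ((Aᴴ * A) i i).re = ∑ k, ‖A k i‖ ^ 2 := by
  simp only [mul_apply, conjTranspose_apply, Complex.re_sum]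
  refine Finset.sum_congr rfl fun k _ => ?_
  rw [Complex.star_def, ← Complex.normSq_eq_conj_mul_self, Complex.ofReal_re,
    Complex.normSq_eq_norm_sq]

theorem norm_sq_apply_self_le {m : Type*} [Fintype m] (A : Matrix m m ℂ) (i : m) :
    ‖A i i‖ ^ 2 ≤ ((Aᴴ * A) i i).re := by
  rw [conjTranspose_mul_self_apply_self]
  exact Finset.single_le_sum (f := fun k => ‖A k i‖ ^ 2) (fun _ _ => by positivity)
    (Finset.mem_univ i)

theorem re_apply_self_nonneg {m : Type*} {A : Matrix m m ℂ} (hA : A.PosSemidef) (i : m) :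
    0 ≤ (A i i).re :=
  (Complex.nonneg_iff.1 hA.diag_nonneg).1

section Matrices

variable {m ι κ : Type*} [Fintype m] [DecidableEq m] [Fintype ι] [Fintype κ]

open scoped MatrixOrder in
theorem exists_eq_conjTranspose_mul_self {A : Matrix m m ℂ} (hA : A.PosSemidef) :
    ∃ C : Matrix m m ℂ, A = Cᴴ * C :=
  CStarAlgebra.nonneg_iff_eq_star_mul_self.mp hA.nonneg

theorem row_eq_zero_of_posSemidef {A : Matrix m m ℂ} (hA : A.PosSemidef) {i : m}
    (h : (A i i).re = 0) (j : m) : A i j = 0 := by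
  obtain ⟨C, rfl⟩ := exists_eq_conjTranspose_mul_self hA
  rw [conjTranspose_mul_self_apply_self,
    Finset.sum_eq_zero_iff_of_nonneg (fun _ _ => by positivity)] at h
  rw [mul_apply]
  refine Finset.sum_eq_zero fun k _ => ?_
  have := h k (Finset.mem_univ k)
  simp only [ne_eq, OfNat.ofNat_ne_zero, not_false_eq_true, pow_eq_zero_iff, norm_eq_zero] at this
  simp [conjTranspose_apply, this]

theorem re_trace_mul_nonneg {A B : Matrix m m ℂ} (hA : A.PosSemidef) (hB : B.PosSemidef) :
    0 ≤ (A * B).trace.re := by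
  obtain ⟨C, rfl⟩ := exists_eq_conjTranspose_mul_self hB
  rw [← Matrix.mul_assoc, trace_mul_comm, ← Matrix.mul_assoc]
  exact (Complex.nonneg_iff.1 (hA.mul_mul_conjTranspose_same C).trace_nonneg).1

/-- The Kadison–Schwarz inequality for the map `a ↦ ∑ x, a x • X x` induced by a POVM. -/
theorem IsPOVM.posSemidef_sub_conjTranspose_mul_self {X : ι → Matrix m m ℂ} (hX : IsPOVM X)
    (a : ι → ℂ) :
    ((∑ x, ((‖a x‖ ^ 2 : ℝ) : ℂ) • X x) - (∑ x, a x • X x)ᴴ * ∑ x, a x • X x).PosSemidef := by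
  set A := ∑ x, a x • X x with hA
  have hAH : Aᴴ = ∑ x, star (a x) • X x := by
    rw [hA, conjTranspose_sum]
    refine Finset.sum_congr rfl fun x _ => ?_
    rw [conjTranspose_smul, (hX.1 x).isHermitian.eq]
  have hsum : (∑ x, ((‖a x‖ ^ 2 : ℝ) : ℂ) • X x) - Aᴴ * A
      = ∑ x, (a x • (1 : Matrix m m ℂ) - A)ᴴ * X x * (a x • (1 : Matrix m m ℂ) - A) := by
    have hterm : ∀ x, (a x • (1 : Matrix m m ℂ) - A)ᴴ * X x * (a x • (1 : Matrix m m ℂ) - A)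
        = ((‖a x‖ ^ 2 : ℝ) : ℂ) • X x - (star (a x) • X x) * A - Aᴴ * (a x • X x)
          + Aᴴ * X x * A := by
      intro x
      have hn : ((‖a x‖ ^ 2 : ℝ) : ℂ) = a x * star (a x) := by
        rw [Complex.star_def, Complex.mul_conj, Complex.normSq_eq_norm_sq]
      rw [hn, conjTranspose_sub, conjTranspose_smul, conjTranspose_one]
      simp only [sub_mul, mul_sub, smul_mul_assoc, mul_smul_comm, Matrix.one_mul, Matrix.mul_one,
        smul_sub, smul_smul]
      abel
    simp only [hterm, Finset.sum_add_distrib, Finset.sum_sub_distrib, ← Finset.sum_mul,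
      ← Finset.mul_sum, ← hAH, ← hA, hX.2, Matrix.mul_one]
    abel
  rw [hsum]
  exact posSemidef_sum _ fun x _ => (hX.1 x).conjTranspose_mul_mul_same _

theorem IsPOVM.posSemidef_one_sub_conjTranspose_mul_self {X : ι → Matrix m m ℂ} (hX : IsPOVM X)
    {a : ι → ℂ} (ha : ∀ x, ‖a x‖ ≤ 1) :
    (1 - (∑ x, a x • X x)ᴴ * ∑ x, a x • X x).PosSemidef := by
  have h : (∑ x, ((1 - ‖a x‖ ^ 2 : ℝ) : ℂ) • X x).PosSemidef := by
    refine posSemidef_sum _ fun x _ => (hX.1 x).smul ?_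
    rw [Complex.zero_le_real, sub_nonneg]
    exact pow_le_one₀ (norm_nonneg _) (ha x)
  convert h.add (hX.posSemidef_sub_conjTranspose_mul_self a) using 1
  simp only [Complex.ofReal_sub, sub_smul, Finset.sum_sub_distrib, Complex.ofReal_one, one_smul,
    hX.2]
  abel

theorem norm_mul_apply_self_le_one {X : ι → Matrix m m ℂ} (hX : IsPOVM X)
    {Y : κ → Matrix m m ℂ} (hY : IsPOVM Y) {a : ι → ℂ} (ha : ∀ x, ‖a x‖ ≤ 1)
    {b : κ → ℂ} (hb : ∀ y, ‖b y‖ ≤ 1) (i : m) :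
    ‖((∑ x, a x • X x) * ∑ y, b y • Y y) i i‖ ≤ 1 := by
  have hA := (hX.posSemidef_one_sub_conjTranspose_mul_self ha).conjTranspose_mul_mul_same
    (∑ y, b y • Y y)
  have hB := hY.posSemidef_one_sub_conjTranspose_mul_self hb
  set A := ∑ x, a x • X x
  set B := ∑ y, b y • Y y
  have h := re_apply_self_nonneg (hA.add hB) i
  have heq : Bᴴ * (1 - Aᴴ * A) * B + (1 - Bᴴ * B) = 1 - (A * B)ᴴ * (A * B) := by
    rw [conjTranspose_mul]; noncomm_ring
  rw [heq, Matrix.sub_apply, one_apply_eq, Complex.sub_re, Complex.one_re] at h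
  have h2 := norm_sq_apply_self_le (A * B) i
  exact (sq_le_one_iff₀ (norm_nonneg _)).1 (by linarith)

theorem sum_norm_sq_mul_apply_self_le {X : ι → Matrix m m ℂ} (hX : IsPOVM X)
    {Y : κ → Matrix m m ℂ} (hY : IsPOVM Y) (a : ι → ℂ) (b : κ → ℂ) :
    ∑ i, ‖((∑ x, a x • X x) * ∑ y, b y • Y y) i i‖ ^ 2
      ≤ ∑ x, ∑ y, ‖a x‖ ^ 2 * ‖b y‖ ^ 2 * (X x * Y y).trace.re := by
  have hA := hX.posSemidef_sub_conjTranspose_mul_self a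
  have hB := hY.posSemidef_sub_conjTranspose_mul_self (fun y => star (b y))
  have hBH : (∑ y, star (b y) • Y y) = (∑ y, b y • Y y)ᴴ := by
    rw [conjTranspose_sum]
    refine Finset.sum_congr rfl fun y _ => ?_
    rw [conjTranspose_smul, (hY.1 y).isHermitian.eq]
  have hS : (∑ x, ((‖a x‖ ^ 2 : ℝ) : ℂ) • X x).PosSemidef :=
    posSemidef_sum _ fun x _ => (hX.1 x).smul (Complex.zero_le_real.2 (by positivity))
  simp only [hBH, conjTranspose_conjTranspose, norm_star] at hB
  have hrhs : ∑ x, ∑ y, ‖a x‖ ^ 2 * ‖b y‖ ^ 2 * (X x * Y y).trace.re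
      = ((∑ x, ((‖a x‖ ^ 2 : ℝ) : ℂ) • X x) * ∑ y, ((‖b y‖ ^ 2 : ℝ) : ℂ) • Y y).trace.re := by
    simp only [Finset.sum_mul, Finset.mul_sum, trace_sum, Complex.re_sum, smul_mul_assoc,
      mul_smul_comm, trace_smul, smul_eq_mul, Complex.re_ofReal_mul, mul_assoc]
    rw [Finset.sum_comm]
    exact Finset.sum_congr rfl fun x _ => Finset.sum_congr rfl fun y _ => by ring
  rw [hrhs]
  set A := ∑ x, a x • X x
  set B := ∑ y, b y • Y y
  set S := ∑ x, ((‖a x‖ ^ 2 : ℝ) : ℂ) • X x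
  set T := ∑ y, ((‖b y‖ ^ 2 : ℝ) : ℂ) • Y y
  have h1 := re_trace_mul_nonneg hA (posSemidef_self_mul_conjTranspose B)
  have h2 := re_trace_mul_nonneg hS hB
  have h3 : ∑ i, ‖(A * B) i i‖ ^ 2 ≤ ((A * B)ᴴ * (A * B)).trace.re := by
    rw [trace, Complex.re_sum]
    exact Finset.sum_le_sum fun i _ => norm_sq_apply_self_le _ i
  have h4 : ((A * B)ᴴ * (A * B)).trace = (Aᴴ * A * (B * Bᴴ)).trace := by
    rw [conjTranspose_mul, Matrix.mul_assoc, trace_mul_comm]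
    simp only [Matrix.mul_assoc]
  rw [sub_mul, trace_sub, Complex.sub_re] at h1
  rw [mul_sub, trace_sub, Complex.sub_re] at h2
  rw [h4] at h3
  linarith

end Matrices

theorem IsPOVM.conj_unitary {m ι : Type*} [Fintype m] [DecidableEq m] [Fintype ι]
    {X : ι → Matrix m m ℂ} (hX : IsPOVM X) {U : Matrix m m ℂ} (hU : Uᴴ * U = 1) :
    IsPOVM fun x => Uᴴ * X x * U := by
  refine ⟨fun x => (hX.1 x).conjTranspose_mul_mul_same U, ?_⟩
  rw [← Finset.sum_mul, ← Finset.mul_sum, hX.2, Matrix.mul_one, hU]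

theorem norm_exp_half_mul_log_of_re_eq_zero {z : ℂ} (hz : z.re = 0) (p : ℝ) :
    ‖Complex.exp (z * (Real.log p / 2 : ℝ))‖ = 1 := by
  rw [Complex.norm_exp, Complex.re_mul_ofReal, hz, zero_mul, Real.exp_zero]

theorem norm_exp_half_mul_log_sq_of_re_eq_one {z : ℂ} (hz : z.re = 1) {p : ℝ} (hp : 0 < p) :
    ‖Complex.exp (z * (Real.log p / 2 : ℝ))‖ ^ 2 = p := by
  rw [Complex.norm_exp, Complex.re_mul_ofReal, hz, one_mul, ← Real.exp_nat_mul]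
  convert Real.exp_log hp using 2
  push_cast
  ring

/-- The uncertainty relation for two POVMs and a state that is diagonal with spectrum `l`,
in terms of a bound on the overlaps `Tr[X_x Y_y]`. -/
theorem shannon_uncertainty_diagonal {m ι κ : Type*} [Fintype m] [DecidableEq m]
    [Fintype ι] [Fintype κ] {l : m → ℝ} (hl : ∀ i, 0 ≤ l i) (hl1 : ∑ i, l i = 1)
    {X : ι → Matrix m m ℂ} (hX : IsPOVM X) {Y : κ → Matrix m m ℂ} (hY : IsPOVM Y)
    {c : ℝ} (hc : 0 < c) (hXY : ∀ x y, (X x * Y y).trace.re ≤ c) :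
    -Real.log c + ∑ i, Real.negMulLog (l i)
      ≤ ∑ x, Real.negMulLog (∑ i, l i * (X x i i).re)
        + ∑ y, Real.negMulLog (∑ i, l i * (Y y i i).re) := by
  set p : ι → ℝ := fun x => ∑ i, l i * (X x i i).re with hp
  set q : κ → ℝ := fun y => ∑ i, l i * (Y y i i).re with hq
  have hpterm : ∀ x i, 0 ≤ l i * (X x i i).re := fun x i =>
    mul_nonneg (hl i) (re_apply_self_nonneg (hX.1 x) i)
  have hqterm : ∀ y i, 0 ≤ l i * (Y y i i).re := fun y i =>
    mul_nonneg (hl i) (re_apply_self_nonneg (hY.1 y) i)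
  have hp0 : ∀ x, 0 ≤ p x := fun x => Finset.sum_nonneg fun i _ => hpterm x i
  have hq0 : ∀ y, 0 ≤ q y := fun y => Finset.sum_nonneg fun i _ => hqterm y i
  have hp1 : ∑ x, p x = 1 := by
    rw [hp, Finset.sum_comm]
    simp_rw [← Finset.mul_sum, ← Complex.re_sum, ← Matrix.sum_apply, hX.2]
    simpa using hl1
  have hq1 : ∑ y, q y = 1 := by
    rw [hq, Finset.sum_comm]
    simp_rw [← Finset.mul_sum, ← Complex.re_sum, ← Matrix.sum_apply, hY.2]
    simpa using hl1
  have hXzero : ∀ x i y, p x = 0 → (l i : ℂ) * (X x * Y y) i i = 0 := by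
    intro x i y h
    have := (Finset.sum_eq_zero_iff_of_nonneg fun i _ => hpterm x i).1 h i (Finset.mem_univ i)
    rcases mul_eq_zero.1 this with h | h
    · simp [h]
    · simp [mul_apply, row_eq_zero_of_posSemidef (hX.1 x) h]
  have hYzero : ∀ x i y, q y = 0 → (l i : ℂ) * (X x * Y y) i i = 0 := by
    intro x i y h
    have := (Finset.sum_eq_zero_iff_of_nonneg fun i _ => hqterm y i).1 h i (Finset.mem_univ i)
    rcases mul_eq_zero.1 this with h | h
    · simp [h]
    · have hcol : ∀ j, Y y j i = 0 := fun j => by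
        rw [← (hY.1 y).isHermitian.apply, row_eq_zero_of_posSemidef (hY.1 y) h, star_zero]
      simp [mul_apply, hcol]
  set w : m × ι × κ → ℂ := fun k => (l k.1 : ℂ) * (X k.2.1 * Y k.2.2) k.1 k.1 with hw
  set θ : m × ι × κ → ℝ := fun k =>
    Real.log (p k.2.1) / 2 + Real.log (q k.2.2) / 2 - Real.log (l k.1) / 2 with hθ
  have hsumX : ∀ i y, ∑ x, (X x * Y y) i i = Y y i i := fun i y => by
    rw [← Matrix.sum_apply, ← Finset.sum_mul, hX.2, Matrix.one_mul]
  have hsumY : ∀ i x, ∑ y, (X x * Y y) i i = X x i i := fun i x => by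
    rw [← Matrix.sum_apply, ← Finset.mul_sum, hY.2, Matrix.mul_one]
  have hw1 : ∑ k, w k = 1 := by
    simp only [hw, Fintype.sum_prod_type, ← Finset.mul_sum, hsumY]
    simp only [← Matrix.sum_apply, hX.2, one_apply_eq, mul_one]
    exact_mod_cast hl1
  have hwθ : ∑ k, (w k).re * θ k = (∑ x, p x * Real.log (p x)) / 2
      + (∑ y, q y * Real.log (q y)) / 2 - (∑ i, l i * Real.log (l i)) / 2 := by
    simp only [hθ, mul_sub, mul_add, Finset.sum_add_distrib, Finset.sum_sub_distrib]
    congr 1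
    · congr 1
      · simp only [Finset.sum_div, hw, Fintype.sum_prod_type, ← Finset.sum_mul,
          Complex.re_ofReal_mul, ← Finset.mul_sum, ← Complex.re_sum, hsumY]
        rw [Finset.sum_comm]
        refine Finset.sum_congr rfl fun x _ => ?_
        rw [← Finset.sum_mul, mul_div_assoc]
      · simp only [Finset.sum_div, hw, Fintype.sum_prod_type]
        rw [Finset.sum_congr rfl fun i _ => Finset.sum_comm, Finset.sum_comm]
        refine Finset.sum_congr rfl fun y _ => ?_
        simp only [← Finset.sum_mul, Complex.re_ofReal_mul, ← Finset.mul_sum, ← Complex.re_sum,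
          hsumX]
        rw [mul_div_assoc]
    · simp only [Finset.sum_div, hw, Fintype.sum_prod_type, ← Finset.sum_mul,
        Complex.re_ofReal_mul, ← Finset.mul_sum, ← Complex.re_sum, hsumY]
      simp only [← Matrix.sum_apply, hX.2, one_apply_eq, Complex.one_re, mul_one, mul_div_assoc]
  let a : ℂ → ι → ℂ := fun z x => if p x = 0 then 0 else Complex.exp (z * (Real.log (p x) / 2 : ℝ))
  let b : ℂ → κ → ℂ := fun z y => if q y = 0 then 0 else Complex.exp (z * (Real.log (q y) / 2 : ℝ))
  let γ : ℂ → m → ℂ := fun z i => l i * Complex.exp (-z * (Real.log (l i) / 2 : ℝ))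
  have hfactor : ∀ z : ℂ, ∑ k, w k * Complex.exp (z * θ k)
      = ∑ i, γ z i * ((∑ x, a z x • X x) * ∑ y, b z y • Y y) i i := by
    intro z
    rw [Fintype.sum_prod_type]
    refine Finset.sum_congr rfl fun i _ => ?_
    rw [Finset.sum_mul_sum, Fintype.sum_prod_type]
    simp only [Matrix.sum_apply, Finset.mul_sum]
    refine Finset.sum_congr rfl fun x _ => Finset.sum_congr rfl fun y _ => ?_
    simp only [smul_mul_assoc, mul_smul_comm, Matrix.smul_apply, smul_eq_mul, hw, a, b]
    by_cases hx : p x = 0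
    · simp [hx, hXzero x i y hx]
    by_cases hy : q y = 0
    · simp [hy, hYzero x i y hy]
    have hexp : Complex.exp (z * θ (i, x, y)) = Complex.exp (-z * (Real.log (l i) / 2 : ℝ))
        * (Complex.exp (z * (Real.log (p x) / 2 : ℝ))
          * Complex.exp (z * (Real.log (q y) / 2 : ℝ))) := by
      rw [← Complex.exp_add, ← Complex.exp_add, hθ]
      congr 1
      push_cast
      ring
    rw [if_neg hx, if_neg hy, hexp]
    simp only [γ]
    ring
  have hbound := re_sum_mul_le_log_of_three_lines w θ (Real.sqrt_pos.2 hc) hw1 ?_ ?_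
  · rw [hwθ, Real.log_sqrt hc.le] at hbound
    simp only [Real.negMulLog, neg_mul, Finset.sum_neg_distrib]
    linarith
  · intro z hz
    have hz' : (-z).re = 0 := by simp [hz]
    rw [hfactor, ← hl1]
    refine (norm_sum_le _ _).trans (Finset.sum_le_sum fun i _ => ?_)
    have ha : ∀ x, ‖a z x‖ ≤ 1 := fun x => by
      simp only [a]
      split_ifs
      · simp
      · exact (norm_exp_half_mul_log_of_re_eq_zero hz _).le
    have hb : ∀ y, ‖b z y‖ ≤ 1 := fun y => by
      simp only [b]
      split_ifs
      · simp
      · exact (norm_exp_half_mul_log_of_re_eq_zero hz _).le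
    rw [norm_mul, norm_mul, norm_exp_half_mul_log_of_re_eq_zero hz', mul_one,
      Complex.norm_of_nonneg (hl i)]
    exact mul_le_of_le_one_right (hl i) (norm_mul_apply_self_le_one hX hY ha hb i)
  · intro z hz
    have ha : ∀ x, ‖a z x‖ ^ 2 = p x := fun x => by
      simp only [a]
      split_ifs with h
      · simp [h]
      · exact norm_exp_half_mul_log_sq_of_re_eq_one hz ((hp0 x).lt_of_ne' h)
    have hb : ∀ y, ‖b z y‖ ^ 2 = q y := fun y => by
      simp only [b]
      split_ifs with h
      · simp [h]
      · exact norm_exp_half_mul_log_sq_of_re_eq_one hz ((hq0 y).lt_of_ne' h)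
    have hγ : ∀ i, ‖γ z i‖ ^ 2 = l i := fun i => by
      rcases (hl i).eq_or_lt with h | h
      · simp [γ, ← h]
      · simp only [γ]
        rw [norm_mul, mul_pow, Complex.norm_of_nonneg (hl i), neg_mul, Complex.exp_neg, norm_inv,
          inv_pow, norm_exp_half_mul_log_sq_of_re_eq_one hz h]
        field_simp
    rw [hfactor]
    refine Real.le_sqrt_of_sq_le ?_
    calc ‖∑ i, γ z i * ((∑ x, a z x • X x) * ∑ y, b z y • Y y) i i‖ ^ 2
        ≤ (∑ i, ‖γ z i‖ * ‖((∑ x, a z x • X x) * ∑ y, b z y • Y y) i i‖) ^ 2 := by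
          gcongr
          exact (norm_sum_le _ _).trans_eq (Finset.sum_congr rfl fun i _ => norm_mul _ _)
      _ ≤ (∑ i, ‖γ z i‖ ^ 2) *
            ∑ i, ‖((∑ x, a z x • X x) * ∑ y, b z y • Y y) i i‖ ^ 2 :=
          Finset.sum_mul_sq_le_sq_mul_sq _ _ _
      _ ≤ ∑ x, ∑ y, p x * q y * (X x * Y y).trace.re := by
          simp only [hγ, hl1, one_mul, ← ha, ← hb]
          exact sum_norm_sq_mul_apply_self_le hX hY _ _
      _ ≤ ∑ x, ∑ y, p x * q y * c :=
          Finset.sum_le_sum fun x _ => Finset.sum_le_sum fun y _ =>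
            mul_le_mul_of_nonneg_left (hXY x y) (mul_nonneg (hp0 x) (hq0 y))
      _ = c := by
          simp only [← Finset.sum_mul, ← Finset.mul_sum, hp1, hq1, one_mul, mul_one]

/-- The uncertainty relation for two arbitrary POVMs, in terms of a bound on the overlaps
`Tr[X_x Y_y]`. -/
theorem shannon_uncertainty_of_trace_le {m ι κ : Type*} [Fintype m] [DecidableEq m]
    [Fintype ι] [Fintype κ] {ρ : Matrix m m ℂ} (hρ : IsDensity ρ)
    {X : ι → Matrix m m ℂ} (hX : IsPOVM X) {Y : κ → Matrix m m ℂ} (hY : IsPOVM Y)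
    {c : ℝ} (hc : 0 < c) (hXY : ∀ x y, (X x * Y y).trace.re ≤ c) :
    -Real.log c + vnEnt ρ
      ≤ ∑ x, Real.negMulLog (probOf ρ X x) + ∑ y, Real.negMulLog (probOf ρ Y y) := by
  have hH : ρ.IsHermitian := hρ.1.isHermitian
  set U : Matrix m m ℂ := (hH.eigenvectorUnitary : Matrix m m ℂ) with hUdef
  set l : m → ℝ := hH.eigenvalues
  have hU : Uᴴ * U = 1 := Unitary.coe_star_mul_self hH.eigenvectorUnitary
  have hU' : U * Uᴴ = 1 := Unitary.coe_mul_star_self hH.eigenvectorUnitary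
  have hspec : ρ = U * diagonal (fun i => (l i : ℂ)) * Uᴴ := by
    have h := hH.spectral_theorem
    rwa [Unitary.conjStarAlgAut_apply] at h
  have htr : ∀ A : Matrix m m ℂ, (ρ * A).trace.re = ∑ i, l i * ((Uᴴ * A * U) i i).re := by
    intro A
    have h : (ρ * A).trace = (diagonal (fun i => (l i : ℂ)) * (Uᴴ * A * U)).trace := by
      conv_lhs => rw [hspec]
      rw [Matrix.mul_assoc, Matrix.mul_assoc, trace_mul_comm]
      simp only [Matrix.mul_assoc]
    rw [h]
    simp only [trace, diag_apply, diagonal_mul, Complex.re_sum, Complex.re_ofReal_mul]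
  have hl1 : ∑ i, l i = 1 := by
    have h := htr 1
    rw [Matrix.mul_one, hρ.2, Matrix.mul_one, hU] at h
    simpa using h.symm
  have hvn : vnEnt ρ = ∑ i, Real.negMulLog (l i) := by
    have hlog : Uᴴ * mlog ρ * U = diagonal fun i => ((Real.log (l i) : ℝ) : ℂ) := by
      rw [mlog, dif_pos hH, star_eq_conjTranspose, ← hUdef, ← Matrix.mul_assoc,
        ← Matrix.mul_assoc, hU, Matrix.one_mul, Matrix.mul_assoc, hU, Matrix.mul_one]
    rw [vnEnt, htr, hlog]
    simp only [diagonal_apply_eq, Complex.ofReal_re, Real.negMulLog, neg_mul,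
      Finset.sum_neg_distrib]
  have hconj : ∀ x y, (Uᴴ * X x * U * (Uᴴ * Y y * U)).trace.re ≤ c := by
    intro x y
    have h : Uᴴ * X x * U * (Uᴴ * Y y * U) = Uᴴ * (X x * Y y * U) := by
      calc _ = Uᴴ * X x * (U * Uᴴ) * Y y * U := by simp only [Matrix.mul_assoc]
        _ = _ := by rw [hU', Matrix.mul_one]; simp only [Matrix.mul_assoc]
    rw [h, trace_mul_comm, Matrix.mul_assoc, hU', Matrix.mul_one]
    exact hXY x y
  have h := shannon_uncertainty_diagonal (fun i => hρ.1.eigenvalues_nonneg i) hl1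
    (hX.conj_unitary hU) (hY.conj_unitary hU) hc hconj
  simpa only [hvn, probOf, htr] using h

/-- Strong Shannon entropic uncertainty relation for a rank-1 POVM
`X_x = |x⟩⟨x|` and an arbitrary POVM `Y`:
`H(X|ρ) + H(Y|ρ) ≥ -log max_{x,y} ⟨x|Y_y|x⟩ + H(ρ)`. -/
theorem shannon_uncertainty_rank_one
    {n : ℕ} {ι κ : Type*} [Fintype ι] [Fintype κ]
    (ρ : Matrix (Fin n) (Fin n) ℂ) (hρ : IsDensity ρ)
    (u : ι → (Fin n → ℂ))
    (hXsum : ∑ x, vecMulVec (u x) (star (u x)) = 1)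
    (Y : κ → Matrix (Fin n) (Fin n) ℂ) (hY : IsPOVM Y) :
    - Real.log (⨆ x, ⨆ y, (star (u x) ⬝ᵥ (Y y *ᵥ u x)).re) + vnEnt ρ
      ≤ (∑ x, Real.negMulLog (probOf ρ (fun x => vecMulVec (u x) (star (u x))) x))
        + ∑ y, Real.negMulLog (probOf ρ Y y) := by
  have hX : IsPOVM fun x => vecMulVec (u x) (star (u x)) :=
    ⟨fun x => posSemidef_vecMulVec_self_star (u x), hXsum⟩
  set c := ⨆ x, ⨆ y, (star (u x) ⬝ᵥ (Y y *ᵥ u x)).re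
  have htr : ∀ x y, (vecMulVec (u x) (star (u x)) * Y y).trace
      = star (u x) ⬝ᵥ (Y y *ᵥ u x) := fun x y => by
    rw [vecMulVec_mul, trace_vecMulVec, dotProduct_comm, ← dotProduct_mulVec]
  have hle : ∀ x y, (vecMulVec (u x) (star (u x)) * Y y).trace.re ≤ c := fun x y => by
    rw [htr]
    exact (le_ciSup (f := fun y => (star (u x) ⬝ᵥ (Y y *ᵥ u x)).re)
      (Set.finite_range _).bddAbove y).trans
      (le_ciSup (f := fun x => ⨆ y, (star (u x) ⬝ᵥ (Y y *ᵥ u x)).re)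
        (Set.finite_range _).bddAbove x)
  have hc : 0 < c := by
    by_contra! hc
    have hsum : ∑ x, ∑ y, (vecMulVec (u x) (star (u x)) * Y y).trace.re = n := by
      simp only [← Complex.re_sum, ← trace_sum, ← Finset.mul_sum, ← Finset.sum_mul, hXsum, hY.2]
      simp
    have hn : (n : ℝ) ≤ 0 := hsum ▸ Finset.sum_nonpos fun x _ => Finset.sum_nonpos fun y _ =>
      (hle x y).trans hc
    have hn0 : n = 0 := by exact_mod_cast le_antisymm hn n.cast_nonneg
    subst hn0
    simpa [trace] using hρ.2
  exact shannon_uncertainty_of_trace_le hρ hX hY hc hle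

end QC
end
end

section
/- Let ρ be a density matrix on ℂ^n with spectral decomposition ρ = Σ_j e_j E_j (E_j the orthogonal projection onto the eigenspace of eigenvalue e_j), let X = {X_x} be an arbitrary discrete POVM on ℂ^n, and let α ∈ [1/2,1) ∪ (1,∞). Then H_α(X|ρ) ≥ −log max_{x, j : e_j > 0} λ_max(E_j X_x E_j). -/
noncomputable section
open scoped BigOperators Classical ComplexOrder
open Matrix

namespace QC

open scoped MatrixOrder in
theorem trace_mul_nonneg {m : Type*} [Fintype m] [DecidableEq m] {A B : Matrix m m ℂ}
    (hA : A.PosSemidef) (hB : B.PosSemidef) : 0 ≤ (A * B).trace := by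
  obtain ⟨C, rfl⟩ := CStarAlgebra.nonneg_iff_eq_star_mul_self.1 hA.nonneg
  rw [trace_mul_comm, ← mul_assoc, trace_mul_comm, ← mul_assoc]
  exact (hB.mul_mul_conjTranspose_same C).trace_nonneg

theorem eigs_of_isHermitian {m : Type*} [Fintype m] [DecidableEq m] {A : Matrix m m ℂ}
    (hA : A.IsHermitian) : eigs A = hA.eigenvalues :=
  dif_pos hA

theorem lamMax_nonneg {m : Type*} [Fintype m] [DecidableEq m] {A : Matrix m m ℂ}
    (hA : A.PosSemidef) : 0 ≤ lamMax A := by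
  refine Real.iSup_nonneg fun i => ?_
  rw [eigs_of_isHermitian hA.1]
  exact hA.eigenvalues_nonneg i

theorem posSemidef_lamMax_smul_one_sub {m : Type*} [Fintype m] [DecidableEq m]
    {A : Matrix m m ℂ} (hA : A.IsHermitian) :
    ((lamMax A : ℂ) • (1 : Matrix m m ℂ) - A).PosSemidef := by
  have hle : ∀ i, hA.eigenvalues i ≤ lamMax A := fun i => by
    rw [← eigs_of_isHermitian hA]
    exact le_ciSup (Set.finite_range (eigs A)).bddAbove i
  set U : Matrix m m ℂ := (hA.eigenvectorUnitary : Matrix m m ℂ)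
  have hUU : U * star U = 1 := Unitary.coe_mul_star_self hA.eigenvectorUnitary
  have hspec : A = U * diagonal (RCLike.ofReal ∘ hA.eigenvalues) * star U := by
    have h := hA.spectral_theorem
    rwa [Unitary.conjStarAlgAut_apply] at h
  have hdiag : (diagonal fun i => ((lamMax A - hA.eigenvalues i : ℝ) : ℂ)).PosSemidef := by
    rw [posSemidef_diagonal_iff]
    intro i
    exact_mod_cast sub_nonneg.2 (hle i)
  convert hdiag.mul_mul_conjTranspose_same U using 1
  have hsub : (diagonal fun i => ((lamMax A - hA.eigenvalues i : ℝ) : ℂ)) =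
      (lamMax A : ℂ) • (1 : Matrix m m ℂ) - diagonal (RCLike.ofReal ∘ hA.eigenvalues) := by
    rw [smul_one_eq_diagonal, diagonal_sub]
    simp
  rw [hsub, mul_sub, sub_mul, ← star_eq_conjTranspose, ← hspec, mul_smul_comm, smul_mul_assoc,
    mul_one, hUU]

/-- The trace of a matrix compressed by a projection `E` is at most its largest eigenvalue times
the trace of `E`. -/
theorem trace_compression_le {m : Type*} [Fintype m] [DecidableEq m] {E A : Matrix m m ℂ}
    (hE : E.IsHermitian) (hEE : E * E = E) (hA : A.IsHermitian) :
    (E * A * E).trace.re ≤ lamMax (E * A * E) * E.trace.re := by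
  have hEA : (E * A * E).IsHermitian := by
    have h := isHermitian_mul_mul_conjTranspose E hA
    rwa [hE.eq] at h
  have h := ((posSemidef_lamMax_smul_one_sub hEA).mul_mul_conjTranspose_same E).trace_nonneg
  have hEEA : E * (E * A * E) * E = E * A * E := by
    simp only [mul_assoc, hEE]
    rw [← mul_assoc E E, hEE]
  rw [hE.eq, mul_sub, sub_mul, hEEA, mul_smul_comm, mul_one, smul_mul_assoc, hEE,
    trace_sub, trace_smul, smul_eq_mul] at h
  have h' := (Complex.le_def.1 h).1
  rw [Complex.sub_re, Complex.re_ofReal_mul, Complex.zero_re] at h'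
  linarith

theorem trace_projection_mul {m : Type*} [Fintype m] [DecidableEq m] {E : Matrix m m ℂ}
    (hEE : E * E = E) (A : Matrix m m ℂ) : (E * A * E).trace = (E * A).trace := by
  rw [trace_mul_comm, ← mul_assoc, hEE]

theorem IsProjective.mul_self {m ι : Type*} [Fintype m] [DecidableEq m] [Fintype ι]
    {X : ι → Matrix m m ℂ} (hX : IsProjective X) (x : ι) : X x * X x = X x := by
  rw [hX.2, if_pos rfl]

theorem IsProjective.posSemidef {m ι : Type*} [Fintype m] [DecidableEq m] [Fintype ι]
    {X : ι → Matrix m m ℂ} (hX : IsProjective X) (x : ι) : (X x).PosSemidef := by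
  have h := posSemidef_conjTranspose_mul_self (X x)
  rwa [(hX.1 x).eq, hX.mul_self] at h

theorem IsProjective.mul_sum_smul {m J : Type*} [Fintype m] [DecidableEq m] [Fintype J]
    {E : J → Matrix m m ℂ} (hE : IsProjective E) (e : J → ℝ) (j : J) :
    E j * ∑ k, (e k : ℂ) • E k = (e j : ℂ) • E j := by
  simp [Finset.mul_sum, hE.2]

theorem IsProjective.posSemidef_compression {m J : Type*} [Fintype m] [DecidableEq m]
    [Fintype J] {E : J → Matrix m m ℂ} (hE : IsProjective E)
    {A : Matrix m m ℂ} (hA : A.PosSemidef) (j : J) : (E j * A * E j).PosSemidef := by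
  have h := hA.mul_mul_conjTranspose_same (E j)
  rwa [(hE.1 j).eq] at h

theorem probOf_sum_smul {m ι J : Type*} [Fintype m] [DecidableEq m] [Fintype J]
    (e : J → ℝ) (E : J → Matrix m m ℂ) (X : ι → Matrix m m ℂ) (x : ι) :
    probOf (∑ j, (e j : ℂ) • E j) X x = ∑ j, e j * (E j * X x).trace.re := by
  simp [probOf, Finset.sum_mul, trace_sum]

theorem sum_probOf {m ι : Type*} [Fintype m] [DecidableEq m] [Fintype ι]
    {ρ : Matrix m m ℂ} (hρ : IsDensity ρ) {X : ι → Matrix m m ℂ} (hX : IsPOVM X) :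
    ∑ x, probOf ρ X x = 1 := by
  simp only [probOf]
  rw [← Complex.re_sum, ← trace_sum, ← Finset.mul_sum, hX.2, mul_one, hρ.2, Complex.one_re]

/-- A probability distribution bounded by `M` has Rényi entropy at least `-log M`. -/
theorem neg_log_le_renyiH {ι : Type*} [Fintype ι] {p : ι → ℝ} {α M : ℝ}
    (hα : 0 < α) (hα1 : α ≠ 1) (hp : ∀ x, 0 ≤ p x) (hsum : ∑ x, p x = 1)
    (hM : ∀ x, p x ≤ M) : -Real.log M ≤ renyiH α p := by
  obtain ⟨x₀, -, hx₀⟩ : ∃ x ∈ Finset.univ, 0 < p x := by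
    refine Finset.exists_lt_of_sum_lt (f := fun _ => (0 : ℝ)) ?_
    simp [hsum]
  have hMpos : 0 < M := hx₀.trans_le (hM x₀)
  have hpos : 0 < ∑ x, p x ^ α :=
    Finset.sum_pos' (fun x _ => Real.rpow_nonneg (hp x) α)
      ⟨x₀, Finset.mem_univ x₀, Real.rpow_pos_of_pos hx₀ α⟩
  have hsplit : ∀ x, 0 < p x → p x ^ α = p x * p x ^ (α - 1) := fun x hx => by
    rw [Real.rpow_sub_one hx.ne', mul_div_cancel₀ _ hx.ne']
  have hMsum : ∑ x, p x * M ^ (α - 1) = M ^ (α - 1) := by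
    rw [← Finset.sum_mul, hsum, one_mul]
  rw [renyiH, if_neg hα1]
  rcases hα1.lt_or_gt with h | h
  · have hle : M ^ (α - 1) ≤ ∑ x, p x ^ α := by
      rw [← hMsum]
      refine Finset.sum_le_sum fun x _ => ?_
      rcases (hp x).eq_or_lt with hx | hx
      · simp [← hx, Real.zero_rpow hα.ne']
      · rw [hsplit x hx]
        exact mul_le_mul_of_nonneg_left
          (Real.rpow_le_rpow_of_nonpos hx (hM x) (by linarith)) hx.le
    have hlog := Real.log_le_log (Real.rpow_pos_of_pos hMpos _) hle
    rw [Real.log_rpow hMpos] at hlog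
    rw [inv_mul_eq_div, le_div_iff₀ (by linarith)]
    linarith
  · have hle : ∑ x, p x ^ α ≤ M ^ (α - 1) := by
      rw [← hMsum]
      refine Finset.sum_le_sum fun x _ => ?_
      rcases (hp x).eq_or_lt with hx | hx
      · simp [← hx, Real.zero_rpow hα.ne']
      · rw [hsplit x hx]
        exact mul_le_mul_of_nonneg_left
          (Real.rpow_le_rpow hx.le (hM x) (by linarith)) hx.le
    have hlog := Real.log_le_log hpos hle
    rw [Real.log_rpow hMpos] at hlog
    rw [inv_mul_eq_div, le_div_iff_of_neg (by linarith)]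
    linarith

/-- Lower bound for the Rényi entropy of an arbitrary POVM in terms of the
spectral projections of the state: `H_α(X|ρ) ≥ -log max_{x, j : e_j > 0} λ_max(E_j X_x E_j)`. -/
theorem renyi_entropy_incompatibility_lower_bound
    {n : ℕ} {ι J : Type*} [Fintype ι] [Fintype J]
    (ρ : Matrix (Fin n) (Fin n) ℂ) (hρ : IsDensity ρ)
    (X : ι → Matrix (Fin n) (Fin n) ℂ) (hX : IsPOVM X)
    (e : J → ℝ) (Epr : J → Matrix (Fin n) (Fin n) ℂ)
    (hE : IsProjective Epr) (hEsum : ∑ j, Epr j = 1)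
    (hinj : Function.Injective e)
    (hspec : ρ = ∑ j, (e j : ℂ) • Epr j)
    (α : ℝ) (hα : α ∈ Set.Ico (1/2 : ℝ) 1 ∪ Set.Ioi (1 : ℝ)) :
    - Real.log (⨆ x, ⨆ j, ⨆ (_ : 0 < e j), lamMax (Epr j * X x * Epr j))
      ≤ renyiH α (probOf ρ X) := by
  have hα0 : 0 < α := by
    rcases hα with h | h
    · linarith [h.1]
    · linarith [Set.mem_Ioi.1 h]
  have hα1 : α ≠ 1 := by
    rcases hα with h | h
    · exact h.2.ne
    · exact (Set.mem_Ioi.1 h).ne'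
  set M : ℝ := ⨆ x, ⨆ j, ⨆ (_ : 0 < e j), lamMax (Epr j * X x * Epr j)
  have hcomp : ∀ j x, (Epr j * X x * Epr j).PosSemidef := fun j x =>
    hE.posSemidef_compression (hX.1 x) j
  have htr : ∀ j x, (Epr j * X x * Epr j).trace.re = (Epr j * X x).trace.re := fun j x => by
    rw [trace_projection_mul (hE.mul_self j)]
  have htr_nonneg : ∀ j x, 0 ≤ (Epr j * X x).trace.re := fun j x =>
    (Complex.le_def.1 (trace_mul_nonneg (hE.posSemidef j) (hX.1 x))).1
  have hweight : ∀ j, 0 ≤ e j * (Epr j).trace.re := fun j => by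
    have h := (Complex.le_def.1 (hE.posSemidef_compression hρ.1 j).trace_nonneg).1
    rwa [hspec, hE.mul_sum_smul, smul_mul_assoc, hE.mul_self, trace_smul, smul_eq_mul,
      Complex.re_ofReal_mul, Complex.zero_re] at h
  have hM0 : 0 ≤ M := Real.iSup_nonneg fun x => Real.iSup_nonneg fun j =>
    Real.iSup_nonneg fun _ => lamMax_nonneg (hcomp j x)
  have hlam : ∀ j x, 0 < e j → lamMax (Epr j * X x * Epr j) ≤ M := fun j x hj => by
    have hx := le_ciSup (Set.finite_range fun x => ⨆ j, ⨆ (_ : 0 < e j),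
      lamMax (Epr j * X x * Epr j)).bddAbove x
    have hjx := le_ciSup (Set.finite_range fun j => ⨆ (_ : 0 < e j),
      lamMax (Epr j * X x * Epr j)).bddAbove j
    simp only [ciSup_pos hj] at hjx
    exact hjx.trans hx
  have hsumE : ∑ j, e j * (Epr j).trace.re = 1 := by
    have h := congrArg Complex.re hρ.2
    simpa [hspec, trace_sum] using h
  refine neg_log_le_renyiH hα0 hα1 (fun x => ?_) (sum_probOf hρ hX) fun x => ?_
  · exact (Complex.le_def.1 (trace_mul_nonneg hρ.1 (hX.1 x))).1
  · rw [hspec, probOf_sum_smul, ← one_mul M, ← hsumE, Finset.sum_mul]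
    refine Finset.sum_le_sum fun j _ => ?_
    rcases lt_or_ge 0 (e j) with hj | hj
    · rw [mul_assoc, ← htr]
      refine mul_le_mul_of_nonneg_left ?_ hj.le
      rw [mul_comm]
      exact (trace_compression_le (hE.1 j) (hE.mul_self j) (hX.1 x).1).trans
        (mul_le_mul_of_nonneg_right (hlam j x hj)
          (Complex.le_def.1 (hE.posSemidef j).trace_nonneg).1)
    · exact (mul_nonpos_of_nonpos_of_nonneg hj (htr_nonneg j x)).trans
        (mul_nonneg (hweight j) hM0)

end QC
end
end

section
/- Let X = {X_x} be a projective observable on ℂ^n and let ρ be a density matrix on ℂ^n. Then the infimum over all density matrices σ of the quantum relative entropy D_1(ρ‖σ_X) (equivalently, the infimum of D_1(ρ‖σ) over all density matrices σ commuting with every X_x) equals D_1(ρ‖ρ_X) = H(ρ_X) − H(ρ), where σ_X := Σ_x X_x σ X_x and H denotes the von Neumann entropy. -/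
noncomputable section
open scoped BigOperators Classical ComplexOrder
open Matrix

namespace QC

/-- Quantum relative entropy `D_1(ρ‖σ)`, `+∞` when the support of `ρ` is not
contained in the support of `σ`. -/
noncomputable def D1 {m : Type*} [Fintype m] [DecidableEq m]
    (ρ σ : Matrix m m ℂ) : EReal :=
  if suppLE ρ σ then ((relEnt ρ σ : ℝ) : EReal) else ⊤

section Support

variable {m : Type*} [Fintype m] [DecidableEq m]

theorem suppLE_iff_exists_mul (A B : Matrix m m ℂ) : suppLE A B ↔ ∃ C, A = B * C := by
  constructor
  · intro h
    have h' : ∀ j, ∃ c : m → ℂ, B *ᵥ c = A *ᵥ Pi.single j 1 := fun j => by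
      have := h (LinearMap.mem_range_self (Matrix.toLin' A) (Pi.single j 1))
      simpa [LinearMap.mem_range, Matrix.toLin'_apply] using this
    choose c hc using h'
    refine ⟨Matrix.of fun i j => c j i, ?_⟩
    ext i j
    have := congrFun (hc j) i
    rw [Matrix.mulVec_single_one, Matrix.col_apply] at this
    rw [← this]
    rfl
  · rintro ⟨C, rfl⟩
    unfold suppLE
    rw [Matrix.toLin'_mul]
    exact LinearMap.range_comp_le_range _ _

theorem _root_.Matrix.IsHermitian.eq_conj_diagonal {A : Matrix m m ℂ} (hA : A.IsHermitian) :
    A = (hA.eigenvectorUnitary : Matrix m m ℂ) *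
      Matrix.diagonal (fun i => ((hA.eigenvalues i : ℝ) : ℂ)) *
      star (hA.eigenvectorUnitary : Matrix m m ℂ) := by
  conv_lhs => rw [hA.spectral_theorem, Unitary.conjStarAlgAut_apply]
  rfl

theorem _root_.Matrix.IsHermitian.exists_mul_mul_self {A : Matrix m m ℂ} (hA : A.IsHermitian) :
    ∃ S, A * S * A = A := by
  have hU : star (hA.eigenvectorUnitary : Matrix m m ℂ) * hA.eigenvectorUnitary = 1 :=
    Unitary.coe_star_mul_self _
  set U := (hA.eigenvectorUnitary : Matrix m m ℂ)
  set D := Matrix.diagonal (fun i => ((hA.eigenvalues i : ℝ) : ℂ)) with hD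
  have hAD : A = U * D * star U := hA.eq_conj_diagonal
  refine ⟨U * Matrix.diagonal (fun i => ((hA.eigenvalues i : ℝ) : ℂ)⁻¹) * star U, ?_⟩
  have hDD : D * Matrix.diagonal (fun i => ((hA.eigenvalues i : ℝ) : ℂ)⁻¹) * D = D := by
    simp [hD, Matrix.diagonal_mul_diagonal]
  calc _ = U * D * star U * (U * Matrix.diagonal (fun i => ((hA.eigenvalues i : ℝ) : ℂ)⁻¹) *
        star U) * (U * D * star U) := by rw [← hAD]
    _ = U * (D * (star U * U) * Matrix.diagonal (fun i => ((hA.eigenvalues i : ℝ) : ℂ)⁻¹) *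
        (star U * U) * D) * star U := by simp only [Matrix.mul_assoc]
    _ = A := by rw [hU, Matrix.mul_one, Matrix.mul_one, hDD, ← hAD]

theorem suppLE_of_mulVec_eq_zero {A B : Matrix m m ℂ} (hA : A.IsHermitian) (hB : B.IsHermitian)
    (h : ∀ v, B *ᵥ v = 0 → A *ᵥ v = 0) : suppLE A B := by
  obtain ⟨S, hS⟩ := hB.exists_mul_mul_self
  have hA' : A = A * (S * B) := by
    refine Matrix.ext_of_mulVec_single fun j => ?_
    rw [← sub_eq_zero, ← Matrix.mulVec_mulVec, ← Matrix.mulVec_sub]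
    apply h
    rw [Matrix.mulVec_sub, Matrix.mulVec_mulVec, ← Matrix.mul_assoc, hS, sub_self]
  refine (suppLE_iff_exists_mul A B).2 ⟨Sᴴ * A, ?_⟩
  have := congrArg Matrix.conjTranspose hA'
  rwa [Matrix.conjTranspose_mul, Matrix.conjTranspose_mul, hA.eq, hB.eq, Matrix.mul_assoc] at this

end Support

section Logarithm

variable {m : Type*} [Fintype m] [DecidableEq m]

theorem mlog_eq_cfc {A : Matrix m m ℂ} (hA : A.IsHermitian) : mlog A = cfc Real.log A := by
  rw [hA.cfc_eq, Matrix.IsHermitian.cfc, Unitary.conjStarAlgAut_apply, mlog, dif_pos hA]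
  rfl

theorem commute_mlog {A B : Matrix m m ℂ} (hA : A.IsHermitian) (h : Commute A B) :
    Commute (mlog A) B := by
  rw [mlog_eq_cfc hA]
  exact h.cfc_real Real.log

end Logarithm

section Klein

variable {m : Type*} [Fintype m] [DecidableEq m]

theorem sub_le_mul_log_sub_mul_log {p q : ℝ} (hp : 0 ≤ p) (hq : 0 < q) :
    p - q ≤ p * Real.log p - p * Real.log q := by
  rcases hp.eq_or_lt with rfl | hp
  · simpa using hq.le
  · have := Real.log_le_sub_one_of_pos (div_pos hq hp)
    rw [Real.log_div hq.ne' hp.ne'] at this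
    have h := mul_le_mul_of_nonneg_left this hp.le
    have : p * (q / p - 1) = q - p := by field_simp
    linarith

theorem trace_diagonal_mul_mul_diagonal_mul_star (a b : m → ℝ) (W : Matrix m m ℂ) :
    (Matrix.diagonal (fun i => (a i : ℂ)) * W * Matrix.diagonal (fun i => (b i : ℂ)) *
      star W).trace.re = ∑ i, ∑ j, Complex.normSq (W i j) * (a i * b j) := by
  rw [Matrix.trace, Complex.re_sum]
  refine Finset.sum_congr rfl fun i _ => ?_
  rw [Matrix.diag_apply, Matrix.mul_apply, Complex.re_sum]
  refine Finset.sum_congr rfl fun j _ => ?_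
  rw [Matrix.mul_diagonal, Matrix.diagonal_mul, Matrix.star_apply, Complex.star_def,
    show (a i : ℂ) * W i j * b j * (starRingEnd ℂ) (W i j) =
      (W i j * (starRingEnd ℂ) (W i j)) * (a i * b j) by ring, Complex.mul_conj]
  norm_cast

theorem trace_conj_diagonal_mul_conj_diagonal (a b : m → ℝ) (U V : Matrix m m ℂ) :
    (U * Matrix.diagonal (fun i => (a i : ℂ)) * star U *
      (V * Matrix.diagonal (fun i => (b i : ℂ)) * star V)).trace.re =
      ∑ i, ∑ j, Complex.normSq ((star U * V) i j) * (a i * b j) := by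
  rw [← trace_diagonal_mul_mul_diagonal_mul_star, star_mul, star_star, Matrix.mul_assoc U,
    Matrix.mul_assoc U, Matrix.trace_mul_comm]
  simp only [Matrix.mul_assoc]

theorem sum_normSq_row {W : Matrix m m ℂ} (h : W * star W = 1) (i : m) :
    ∑ j, Complex.normSq (W i j) = 1 := by
  have := congrFun (congrFun h i) i
  rw [Matrix.mul_apply, Matrix.one_apply_eq] at this
  simp only [Matrix.star_apply, Complex.star_def, Complex.mul_conj] at this
  exact_mod_cast this

theorem sum_normSq_col {W : Matrix m m ℂ} (h : star W * W = 1) (j : m) :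
    ∑ i, Complex.normSq (W i j) = 1 := by
  have := congrFun (congrFun h j) j
  rw [Matrix.mul_apply, Matrix.one_apply_eq] at this
  simp only [Matrix.star_apply, Complex.star_def, mul_comm ((starRingEnd ℂ) _),
    Complex.mul_conj] at this
  exact_mod_cast this

theorem sum_eigenvalues_eq_one {A : Matrix m m ℂ} (hA : IsDensity A) :
    ∑ i, hA.1.1.eigenvalues i = 1 := by
  rw [← Complex.ofReal_inj, Complex.ofReal_sum, Complex.ofReal_one]
  exact hA.1.1.trace_eq_sum_eigenvalues.symm.trans hA.2

theorem trace_mul_mlog_self {A : Matrix m m ℂ} (hA : A.IsHermitian) :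
    (A * mlog A).trace.re = ∑ i, hA.eigenvalues i * Real.log (hA.eigenvalues i) := by
  have hU : star (hA.eigenvectorUnitary : Matrix m m ℂ) * hA.eigenvectorUnitary = 1 :=
    Unitary.coe_star_mul_self _
  rw [mlog, dif_pos hA]
  nth_rw 1 [hA.eq_conj_diagonal]
  set U := (hA.eigenvectorUnitary : Matrix m m ℂ)
  set D := Matrix.diagonal (fun i => ((hA.eigenvalues i : ℝ) : ℂ)) with hD
  set L := Matrix.diagonal (fun i => ((Real.log (hA.eigenvalues i) : ℝ) : ℂ)) with hL
  rw [show U * D * star U * (U * L * star U) = U * D * (star U * U) * L * star U by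
    simp only [Matrix.mul_assoc], hU, Matrix.mul_one, Matrix.mul_assoc U, Matrix.trace_mul_comm,
    ← Matrix.mul_assoc, hU, Matrix.one_mul, hD, hL, Matrix.diagonal_mul_diagonal,
    Matrix.trace_diagonal, Complex.re_sum]
  exact Finset.sum_congr rfl fun i _ => by norm_cast

/-- The Klein inequality for density matrices. -/
theorem relEnt_nonneg {A B : Matrix m m ℂ} (hA : IsDensity A) (hB : IsDensity B)
    (h : suppLE A B) : 0 ≤ relEnt A B := by
  have hAh := hA.1.1
  have hBh := hB.1.1
  set p := hAh.eigenvalues with hp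
  set q := hBh.eigenvalues with hq
  have hUU : star (hAh.eigenvectorUnitary : Matrix m m ℂ) * hAh.eigenvectorUnitary = 1 :=
    Unitary.coe_star_mul_self _
  have hUU' : (hAh.eigenvectorUnitary : Matrix m m ℂ) * star (hAh.eigenvectorUnitary : Matrix m m ℂ)
    = 1 := Unitary.coe_mul_star_self _
  have hVV : star (hBh.eigenvectorUnitary : Matrix m m ℂ) * hBh.eigenvectorUnitary = 1 :=
    Unitary.coe_star_mul_self _
  have hVV' : (hBh.eigenvectorUnitary : Matrix m m ℂ) * star (hBh.eigenvectorUnitary : Matrix m m ℂ)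
    = 1 := Unitary.coe_mul_star_self _
  have hAd := hAh.eq_conj_diagonal
  have hBd := hBh.eq_conj_diagonal
  have hlog : mlog B = (hBh.eigenvectorUnitary : Matrix m m ℂ) *
      Matrix.diagonal (fun i => ((Real.log (q i) : ℝ) : ℂ)) *
      star (hBh.eigenvectorUnitary : Matrix m m ℂ) := by rw [mlog, dif_pos hBh]
  set U := (hAh.eigenvectorUnitary : Matrix m m ℂ)
  set V := (hBh.eigenvectorUnitary : Matrix m m ℂ)
  set W := star U * V with hW
  have hWs : star W = star V * U := by rw [hW, star_mul, star_star]
  have hWW' : W * star W = 1 := by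
    rw [hWs, hW, Matrix.mul_assoc, ← Matrix.mul_assoc V, hVV', Matrix.one_mul, hUU]
  have hWW : star W * W = 1 := by
    rw [hWs, hW, Matrix.mul_assoc, ← Matrix.mul_assoc U, hUU', Matrix.one_mul, hVV]
  have hcross : (A * mlog B).trace.re =
      ∑ i, ∑ j, Complex.normSq (W i j) * (p i * Real.log (q j)) := by
    rw [hlog, ← trace_conj_diagonal_mul_conj_diagonal, ← hAd]
  have hzero : ∀ i j, q j = 0 → Complex.normSq (W i j) * p i = 0 := by
    intro i j hj
    obtain ⟨C, hC⟩ := (suppLE_iff_exists_mul A B).1 h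
    have h1 : star W * Matrix.diagonal (fun i => ((p i : ℝ) : ℂ)) =
        Matrix.diagonal (fun i => ((q i : ℝ) : ℂ)) * (star V * C * U) := by
      calc _ = star V * (U * Matrix.diagonal (fun i => ((p i : ℝ) : ℂ)) * star U) * U := by
            rw [hWs]
            simp only [Matrix.mul_assoc, hUU, Matrix.mul_one]
        _ = star V * (V * Matrix.diagonal (fun i => ((q i : ℝ) : ℂ)) * star V * C) * U := by
            rw [← hAd, ← hBd, ← hC]
        _ = (star V * V) * Matrix.diagonal (fun i => ((q i : ℝ) : ℂ)) * (star V * C * U) := by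
            simp only [Matrix.mul_assoc]
        _ = _ := by rw [hVV, Matrix.one_mul]
    have h2 := congrFun (congrFun h1 j) i
    rw [Matrix.mul_diagonal, Matrix.diagonal_mul, hj, Complex.ofReal_zero, zero_mul,
      Matrix.star_apply] at h2
    rcases mul_eq_zero.1 h2 with h3 | h3
    · rw [star_eq_zero.1 h3]; simp
    · rw [Complex.ofReal_eq_zero.1 h3, mul_zero]
  have hself : (A * mlog A).trace.re =
      ∑ i, ∑ j, Complex.normSq (W i j) * (p i * Real.log (p i)) := by
    rw [trace_mul_mlog_self hAh]
    exact Finset.sum_congr rfl fun i _ => by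
      rw [← Finset.sum_mul, sum_normSq_row hWW', one_mul]
  have hp1 : ∑ i, ∑ j, Complex.normSq (W i j) * p i = 1 := by
    rw [← sum_eigenvalues_eq_one hA]
    exact Finset.sum_congr rfl fun i _ => by
      rw [← Finset.sum_mul, sum_normSq_row hWW', one_mul]
  have hq1 : ∑ i, ∑ j, Complex.normSq (W i j) * q j = 1 := by
    rw [← sum_eigenvalues_eq_one hB, Finset.sum_comm]
    exact Finset.sum_congr rfl fun i _ => by
      rw [← Finset.sum_mul, sum_normSq_col hWW, one_mul]
  rw [relEnt, Matrix.mul_sub, Matrix.trace_sub, Complex.sub_re, hself, hcross]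
  calc (0 : ℝ) = ∑ i, ∑ j, Complex.normSq (W i j) * p i - ∑ i, ∑ j, Complex.normSq (W i j) * q j := by
        rw [hp1, hq1, sub_self]
    _ ≤ _ := by
        simp only [← Finset.sum_sub_distrib]
        refine Finset.sum_le_sum fun i _ => Finset.sum_le_sum fun j _ => ?_
        rcases (hB.1.eigenvalues_nonneg j).eq_or_lt with hj | hj
        · have hj' : q j = 0 := hj.symm
          have := hzero i j hj'
          simp [hj', this, ← mul_assoc]
        · have := mul_le_mul_of_nonneg_left
            (sub_le_mul_log_sub_mul_log (hA.1.eigenvalues_nonneg i) hj)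
            (Complex.normSq_nonneg (W i j))
          rwa [mul_sub, mul_sub] at this

end Klein

section Pinching

variable {m ι : Type*} [Fintype m] [DecidableEq m] [Fintype ι] {X : ι → Matrix m m ℂ}

theorem commute_pinch (hX : IsProjective X) (σ : Matrix m m ℂ) (x : ι) :
    X x * pinch X σ = pinch X σ * X x := by
  have hl : X x * pinch X σ = X x * σ * X x := by
    rw [pinch, Finset.mul_sum, Finset.sum_eq_single x]
    · rw [← Matrix.mul_assoc, ← Matrix.mul_assoc, hX.2, if_pos rfl]
    · intro y _ hy
      rw [← Matrix.mul_assoc, ← Matrix.mul_assoc, hX.2, if_neg hy.symm, Matrix.zero_mul,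
        Matrix.zero_mul]
    · simp
  rw [hl, pinch, Finset.sum_mul, Finset.sum_eq_single x]
  · rw [Matrix.mul_assoc (X x * σ), hX.2, if_pos rfl]
  · intro y _ hy
    rw [Matrix.mul_assoc, hX.2, if_neg hy, Matrix.mul_zero]
  · simp

/-- The pinching is self-dual: it drops out against matrices commuting with the observable. -/
theorem trace_pinch_mul (hX : IsProjective X) (hXsum : ∑ x, X x = 1) (A : Matrix m m ℂ)
    {L : Matrix m m ℂ} (hL : ∀ x, Commute L (X x)) :
    (pinch X A * L).trace = (A * L).trace := by
  have h : ∀ x, (X x * A * X x * L).trace = (X x * (A * L)).trace := fun x => by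
    rw [Matrix.mul_assoc, ← (hL x).eq, ← Matrix.mul_assoc, Matrix.trace_mul_comm,
      ← Matrix.mul_assoc, ← Matrix.mul_assoc, hX.2, if_pos rfl, Matrix.mul_assoc]
  rw [pinch, Finset.sum_mul, Matrix.trace_sum, Finset.sum_congr rfl fun x _ => h x,
    ← Matrix.trace_sum, ← Finset.sum_mul, hXsum, Matrix.one_mul]

theorem isDensity_pinch (hX : IsProjective X) (hXsum : ∑ x, X x = 1) {σ : Matrix m m ℂ}
    (hσ : IsDensity σ) : IsDensity (pinch X σ) := by
  constructor
  · refine Matrix.posSemidef_sum _ fun x _ => ?_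
    have := hσ.1.conjTranspose_mul_mul_same (X x)
    rwa [(hX.1 x).eq] at this
  · have := trace_pinch_mul hX hXsum σ (L := 1) fun x => Commute.one_left _
    rw [Matrix.mul_one, Matrix.mul_one] at this
    rw [this, hσ.2]

theorem suppLE_pinch_self (hX : IsProjective X) (hXsum : ∑ x, X x = 1) {ρ : Matrix m m ℂ}
    (hρ : ρ.PosSemidef) (hP : (pinch X ρ).IsHermitian) : suppLE ρ (pinch X ρ) := by
  refine suppLE_of_mulVec_eq_zero hρ.1 hP fun v hv => ?_
  have hterm : ∀ x, star v ⬝ᵥ (X x * ρ * X x) *ᵥ v =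
      star (X x *ᵥ v) ⬝ᵥ ρ *ᵥ (X x *ᵥ v) := fun x => by
    rw [Matrix.star_mulVec, (hX.1 x).eq, ← Matrix.dotProduct_mulVec, Matrix.mulVec_mulVec,
      Matrix.mulVec_mulVec, Matrix.mul_assoc]
  have hsum : ∑ x, star (X x *ᵥ v) ⬝ᵥ ρ *ᵥ (X x *ᵥ v) = 0 := by
    rw [← Finset.sum_congr rfl fun x _ => hterm x, ← dotProduct_sum, ← Matrix.sum_mulVec]
    change star v ⬝ᵥ pinch X ρ *ᵥ v = 0
    rw [hv, dotProduct_zero]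
  have hz := (Finset.sum_eq_zero_iff_of_nonneg fun x _ =>
    hρ.dotProduct_mulVec_nonneg (X x *ᵥ v)).1 hsum
  have hz' : ∀ x, ρ *ᵥ (X x *ᵥ v) = 0 := fun x =>
    (hρ.dotProduct_mulVec_zero_iff _).1 (hz x (Finset.mem_univ x))
  calc ρ *ᵥ v = ρ *ᵥ ((∑ x, X x) *ᵥ v) := by rw [hXsum, Matrix.one_mulVec]
    _ = ∑ x, ρ *ᵥ (X x *ᵥ v) := by rw [Matrix.sum_mulVec, Matrix.mulVec_sum]
    _ = 0 := Finset.sum_eq_zero fun x _ => hz' x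

theorem suppLE_pinch {ρ σ : Matrix m m ℂ} (h : suppLE ρ σ) (hc : ∀ x, X x * σ = σ * X x) :
    suppLE (pinch X ρ) σ := by
  obtain ⟨C, rfl⟩ := (suppLE_iff_exists_mul ρ σ).1 h
  refine (suppLE_iff_exists_mul _ σ).2 ⟨pinch X C, ?_⟩
  rw [pinch, pinch, Finset.mul_sum]
  exact Finset.sum_congr rfl fun x _ => by
    rw [← Matrix.mul_assoc, hc, ← Matrix.mul_assoc, ← Matrix.mul_assoc]

theorem relEnt_eq_add_relEnt_pinch (hX : IsProjective X) (hXsum : ∑ x, X x = 1)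
    {ρ σ : Matrix m m ℂ} (hσ : σ.IsHermitian) (hP : (pinch X ρ).IsHermitian)
    (hc : ∀ x, X x * σ = σ * X x) :
    relEnt ρ σ = relEnt ρ (pinch X ρ) + relEnt (pinch X ρ) σ := by
  have h1 := trace_pinch_mul hX hXsum ρ fun x => commute_mlog hσ (hc x).symm
  have h2 := trace_pinch_mul hX hXsum ρ fun x => commute_mlog hP (commute_pinch hX ρ x).symm
  simp only [relEnt, Matrix.mul_sub, Matrix.trace_sub, Complex.sub_re, h1, h2]
  ring

theorem D1_pinch_self_le (hX : IsProjective X) (hXsum : ∑ x, X x = 1) {ρ σ : Matrix m m ℂ}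
    (hρ : IsDensity ρ) (hσ : IsDensity σ) (hc : ∀ x, X x * σ = σ * X x) :
    D1 ρ (pinch X ρ) ≤ D1 ρ σ := by
  have hP := isDensity_pinch hX hXsum hρ
  by_cases h : suppLE ρ σ
  · rw [D1, D1, if_pos h, if_pos (suppLE_pinch_self hX hXsum hρ.1 hP.1.1), EReal.coe_le_coe_iff,
      relEnt_eq_add_relEnt_pinch hX hXsum hσ.1.1 hP.1.1 hc]
    linarith [relEnt_nonneg hP hσ (suppLE_pinch h hc)]
  · rw [D1, D1, if_neg h]
    exact le_top

theorem D1_pinch_self (hX : IsProjective X) (hXsum : ∑ x, X x = 1) {ρ : Matrix m m ℂ}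
    (hρ : IsDensity ρ) :
    D1 ρ (pinch X ρ) = ((vnEnt (pinch X ρ) - vnEnt ρ : ℝ) : EReal) := by
  have hP := (isDensity_pinch hX hXsum hρ).1.1
  have h := trace_pinch_mul hX hXsum ρ fun x => commute_mlog hP (commute_pinch hX ρ x).symm
  rw [D1, if_pos (suppLE_pinch_self hX hXsum hρ.1 hP), relEnt, vnEnt, vnEnt, Matrix.mul_sub,
    Matrix.trace_sub, Complex.sub_re, h]
  ring_nf

end Pinching

/-- For a projective observable `X` the standard asymmetry evaluates as
`inf_σ D_1(ρ‖σ_X) = inf {D_1(ρ‖σ) : [σ, X_x] = 0 ∀x} = D_1(ρ‖ρ_X) = H(ρ_X) - H(ρ)`. -/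
theorem standard_asymmetry_projective
    {n : ℕ} {ι : Type*} [Fintype ι]
    (X : ι → Matrix (Fin n) (Fin n) ℂ) (hX : IsProjective X) (hXsum : ∑ x, X x = 1)
    (ρ : Matrix (Fin n) (Fin n) ℂ) (hρ : IsDensity ρ) :
    (⨅ σ : {σ : Matrix (Fin n) (Fin n) ℂ // IsDensity σ}, D1 ρ (pinch X σ.1))
        = D1 ρ (pinch X ρ) ∧
    (⨅ σ : {σ : Matrix (Fin n) (Fin n) ℂ // IsDensity σ ∧ ∀ x, X x * σ = σ * X x},
        D1 ρ σ.1) = D1 ρ (pinch X ρ) ∧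
    D1 ρ (pinch X ρ) = ((vnEnt (pinch X ρ) - vnEnt ρ : ℝ) : EReal) := by
  have hP := isDensity_pinch hX hXsum hρ
  refine ⟨le_antisymm (iInf_le_of_le ⟨ρ, hρ⟩ le_rfl) (le_iInf fun σ => ?_),
    le_antisymm (iInf_le_of_le ⟨pinch X ρ, hP, commute_pinch hX ρ⟩ le_rfl) (le_iInf fun σ => ?_),
    D1_pinch_self hX hXsum hρ⟩
  · exact D1_pinch_self_le hX hXsum hρ (isDensity_pinch hX hXsum σ.2) (commute_pinch hX σ.1)
  · exact D1_pinch_self_le hX hXsum hρ σ.2.1 σ.2.2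

end QC
end
end

section
/- Let ρ be a density matrix on ℂ^n and X a Hermitian n×n matrix, and write ⟨X⟩_ρ := Tr[ρX] and Var_ρ(X) := Tr[ρX²] − ⟨X⟩_ρ². Then Var_ρ(X) = −(1/2)Tr[[X,√ρ]²] + (Tr[X√ρX√ρ] − ⟨X⟩_ρ²), and the second (classical) term satisfies Tr[X√ρX√ρ] − ⟨X⟩_ρ² = Tr[(ρ^{1/4}(X − ⟨X⟩_ρ 𝟙)ρ^{1/4})²] ≥ 0. -/
noncomputable section
open scoped BigOperators Classical ComplexOrder
open Matrix

namespace QC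

/-- Exponents add under products of real powers of a positive semidefinite matrix, as long as
their sum does not vanish. -/
theorem mpow_mul_mpow {m : Type*} [Fintype m] [DecidableEq m] {A : Matrix m m ℂ}
    (hA : A.PosSemidef) {r s : ℝ} (hrs : r + s ≠ 0) :
    mpow A r * mpow A s = mpow A (r + s) := by
  have hU : star (hA.isHermitian.eigenvectorUnitary : Matrix m m ℂ) *
      (hA.isHermitian.eigenvectorUnitary : Matrix m m ℂ) = 1 :=
    Unitary.coe_star_mul_self _
  simp only [mpow, hA.isHermitian, dif_pos]
  have hd : Matrix.diagonal (fun i => ((hA.isHermitian.eigenvalues i ^ (r + s) : ℝ) : ℂ)) =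
      Matrix.diagonal (fun i => ((hA.isHermitian.eigenvalues i ^ r : ℝ) : ℂ)) *
      Matrix.diagonal (fun i => ((hA.isHermitian.eigenvalues i ^ s : ℝ) : ℂ)) := by
    rw [Matrix.diagonal_mul_diagonal]
    congr 1
    funext i
    rw [Real.rpow_add' (hA.eigenvalues_nonneg i) hrs, Complex.ofReal_mul]
  rw [hd]
  simp only [Matrix.mul_assoc]
  rw [← Matrix.mul_assoc (star _) _ (_ * star _), hU, Matrix.one_mul]

theorem mpow_one {m : Type*} [Fintype m] [DecidableEq m] {A : Matrix m m ℂ}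
    (hA : A.IsHermitian) : mpow A 1 = A := by
  conv_rhs => rw [hA.spectral_theorem]
  simp [mpow, hA, Unitary.conjStarAlgAut_apply, Function.comp_def]

theorem isHermitian_mpow {m : Type*} [Fintype m] [DecidableEq m] (A : Matrix m m ℂ) (r : ℝ) :
    (mpow A r).IsHermitian := by
  unfold mpow
  split_ifs with h
  · refine Matrix.isHermitian_mul_mul_conjTranspose _ ?_
    exact Matrix.isHermitian_diagonal_of_self_adjoint _ (by
      ext i
      simp)
  · exact Matrix.isHermitian_zero

theorem star_trace_mul_of_isHermitian {m : Type*} [Fintype m] {A B : Matrix m m ℂ}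
    (hA : A.IsHermitian) (hB : B.IsHermitian) : star (A * B).trace = (A * B).trace := by
  rw [← Matrix.trace_conjTranspose, Matrix.conjTranspose_mul, hA.eq, hB.eq, Matrix.trace_mul_comm]

/-- `-(1/2) Tr[[X, S]²] = Tr[S² X²] - Tr[X S X S]`. -/
theorem trace_commutator_mul_self {m : Type*} [Fintype m] (X S : Matrix m m ℂ) :
    -(1/2 : ℂ) * ((X * S - S * X) * (X * S - S * X)).trace =
      (S * S * (X * X)).trace - (X * S * X * S).trace := by
  have h₁ : (X * S * (S * X)).trace = (S * S * (X * X)).trace := by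
    rw [← Matrix.mul_assoc, Matrix.trace_mul_comm, ← Matrix.mul_assoc, ← Matrix.mul_assoc,
      Matrix.mul_assoc, Matrix.trace_mul_comm]
  have h₂ : (S * X * (X * S)).trace = (S * S * (X * X)).trace := by
    rw [← Matrix.mul_assoc, Matrix.trace_mul_comm]
    simp only [Matrix.mul_assoc]
  have h₃ : (S * X * (S * X)).trace = (X * S * X * S).trace := by
    rw [Matrix.mul_assoc, Matrix.trace_mul_comm]
    simp only [Matrix.mul_assoc]
  have h₄ : (X * S * (X * S)).trace = (X * S * X * S).trace := by
    simp only [Matrix.mul_assoc]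
  simp only [sub_mul, mul_sub, Matrix.trace_sub, h₁, h₂, h₃, h₄]
  ring

/-- Cyclicity of the trace moves the outer factors `Q` of a sandwich together. -/
theorem trace_sandwich_mul_self {m : Type*} [Fintype m] (Q Z : Matrix m m ℂ) :
    ((Q * Z * Q) * (Q * Z * Q)).trace = (Z * (Q * Q) * Z * (Q * Q)).trace := by
  rw [Matrix.mul_assoc Q Z Q, Matrix.mul_assoc Q (Z * Q), Matrix.trace_mul_comm]
  simp only [Matrix.mul_assoc]

theorem trace_centered_mul_self {m : Type*} [Fintype m] [DecidableEq m] {ρ S : Matrix m m ℂ}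
    (hS : S * S = ρ) (hρ : ρ.trace = 1) (X : Matrix m m ℂ) :
    ((X - (ρ * X).trace • 1) * S * (X - (ρ * X).trace • 1) * S).trace =
      (X * S * X * S).trace - (ρ * X).trace ^ 2 := by
  have h₁ : (X * S * S).trace = (ρ * X).trace := by
    rw [Matrix.mul_assoc, hS, Matrix.trace_mul_comm]
  have h₂ : (S * X * S).trace = (ρ * X).trace := by
    rw [Matrix.trace_mul_comm, ← Matrix.mul_assoc, hS]
  simp only [sub_mul, mul_sub, Matrix.trace_sub, smul_mul_assoc, mul_smul_comm, one_mul, mul_one,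
    Matrix.trace_smul, smul_eq_mul, h₁, h₂, hS, hρ]
  ring

/-- Luo's quantum-classical decomposition of the variance:
`Var_ρ(X) = -(1/2)Tr[[X,√ρ]²] + (Tr[X√ρX√ρ] - ⟨X⟩²)`, and the classical term equals
`Tr[(ρ^{1/4}(X - ⟨X⟩𝟙)ρ^{1/4})²] ≥ 0`. -/
theorem variance_quantum_classical_decomposition
    {n : ℕ} (ρ X : Matrix (Fin n) (Fin n) ℂ)
    (hρ : IsDensity ρ) (hX : X.IsHermitian) :
    ((ρ * (X * X)).trace - ((ρ * X).trace) ^ 2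
      = -(1/2 : ℂ) *
          ((X * mpow ρ (1/2) - mpow ρ (1/2) * X)
            * (X * mpow ρ (1/2) - mpow ρ (1/2) * X)).trace
        + ((X * mpow ρ (1/2) * X * mpow ρ (1/2)).trace - ((ρ * X).trace) ^ 2)) ∧
    ((X * mpow ρ (1/2) * X * mpow ρ (1/2)).trace - ((ρ * X).trace) ^ 2
      = ((mpow ρ (1/4) * (X - (ρ * X).trace • 1) * mpow ρ (1/4))
          * (mpow ρ (1/4) * (X - (ρ * X).trace • 1) * mpow ρ (1/4))).trace) ∧
    ((X * mpow ρ (1/2) * X * mpow ρ (1/2)).trace - ((ρ * X).trace) ^ 2).im = 0 ∧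
    0 ≤ ((X * mpow ρ (1/2) * X * mpow ρ (1/2)).trace - ((ρ * X).trace) ^ 2).re := by
  obtain ⟨hpos, htr⟩ := hρ
  have hS : mpow ρ (1/2) * mpow ρ (1/2) = ρ := by
    rw [mpow_mul_mpow hpos (by norm_num), add_halves, mpow_one hpos.isHermitian]
  have hQ : mpow ρ (1/4) * mpow ρ (1/4) = mpow ρ (1/2) := by
    rw [mpow_mul_mpow hpos (by norm_num)]
    norm_num
  have hclass : (X * mpow ρ (1/2) * X * mpow ρ (1/2)).trace - ((ρ * X).trace) ^ 2
      = ((mpow ρ (1/4) * (X - (ρ * X).trace • 1) * mpow ρ (1/4))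
          * (mpow ρ (1/4) * (X - (ρ * X).trace • 1) * mpow ρ (1/4))).trace := by
    rw [trace_sandwich_mul_self, hQ, trace_centered_mul_self hS htr]
  have hZ : (X - (ρ * X).trace • 1).IsHermitian := by
    rw [Matrix.IsHermitian, Matrix.conjTranspose_sub, Matrix.conjTranspose_smul, hX.eq,
      star_trace_mul_of_isHermitian hpos.isHermitian hX, Matrix.conjTranspose_one]
  have hY : (mpow ρ (1/4) * (X - (ρ * X).trace • 1) * mpow ρ (1/4)).IsHermitian := by
    have h := Matrix.isHermitian_mul_mul_conjTranspose (mpow ρ (1/4)) hZ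
    rwa [(isHermitian_mpow ρ (1/4)).eq] at h
  have hnonneg :
      0 ≤ (X * mpow ρ (1/2) * X * mpow ρ (1/2)).trace - ((ρ * X).trace) ^ 2 := by
    rw [hclass]
    have h := (Matrix.posSemidef_conjTranspose_mul_self
      (mpow ρ (1/4) * (X - (ρ * X).trace • 1) * mpow ρ (1/4))).trace_nonneg
    rwa [hY.eq] at h
  obtain ⟨hre, him⟩ := Complex.nonneg_iff.mp hnonneg
  refine ⟨?_, hclass, him.symm, hre⟩
  rw [trace_commutator_mul_self, hS]
  ring

end QC
end
end

section
/- Let P and E be orthogonal projection matrices on ℂ^m (Hermitian idempotents). If PEP is also an orthogonal projection (i.e. (PEP)² = PEP), then PE = EP, and consequently E = PEP + (𝟙 − P)E(𝟙 − P). -/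
noncomputable section
open scoped BigOperators Classical ComplexOrder
open Matrix

namespace QC

/-- If `P`, `E` and `PEP` are orthogonal projections then `P` and `E`
commute, and consequently `E = PEP + P^⊥ E P^⊥`. -/
theorem projections_commute_of_compression_is_projection
    {m : ℕ} (P E : Matrix (Fin m) (Fin m) ℂ)
    (hP : P.IsHermitian) (hP2 : P * P = P)
    (hE : E.IsHermitian) (hE2 : E * E = E)
    (h : (P * E * P) * (P * E * P) = P * E * P) :
    P * E = E * P ∧ E = P * E * P + (1 - P) * E * (1 - P) := by
  have hcross : E * P - P * E * P = 0 := by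
    have hstar : (E * P - P * E * P)ᴴ = P * E - P * E * P := by
      simp only [conjTranspose_sub, conjTranspose_mul, hP.eq, hE.eq, Matrix.mul_assoc]
    rw [← conjTranspose_mul_self_eq_zero, hstar]
    calc (P * E - P * E * P) * (E * P - P * E * P)
        = P * (E * E) * P - P * E * P * E * P - P * E * P * E * P
            + P * E * (P * P) * E * P := by noncomm_ring
      _ = P * E * P - P * E * (P * P) * E * P := by
          rw [hE2, hP2]; noncomm_ring
      _ = P * E * P - (P * E * P) * (P * E * P) := by noncomm_ring
      _ = 0 := by rw [h, sub_self]
  have hEP : E * P = P * E * P := sub_eq_zero.mp hcross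
  have hPE : P * E = P * E * P := by
    simpa only [conjTranspose_mul, hP.eq, hE.eq, Matrix.mul_assoc]
      using congrArg conjTranspose hEP
  refine ⟨hPE.trans hEP.symm, ?_⟩
  calc E = P * E * P + (E - P * E * P - P * E * P + P * E * P) := by noncomm_ring
    _ = P * E * P + (E - P * E - E * P + P * E * P) := by rw [hEP, ← hPE]
    _ = P * E * P + (1 - P) * E * (1 - P) := by noncomm_ring

end QC
end
end

section
/- Let {|x⟩}_{x=1}^d and {|y⟩}_{y=1}^d be two orthonormal bases of ℂ^d that are mutually unbiased, i.e. |⟨x|y⟩|² = 1/d for all x, y, and let X and Y be the corresponding rank-1 projective observables with X_x = |x⟩⟨x| and Y_y = |y⟩⟨y|. Then for every density matrix ρ on ℂ^d: (i) Q_1(X|ρ) + H(Y|ρ) ≥ log d, where Q_1(X|ρ) = H(ρ_X) − H(ρ) is the standard asymmetry with ρ_X := Σ_x X_x ρ X_x; and (ii) equivalently, H(X|ρ) + H(Y|ρ) ≥ log d + H(ρ). -/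
noncomputable section
open scoped BigOperators Classical ComplexOrder
open Matrix

namespace QC

lemma hasDerivAt_mul_log_sub {m a r T : ℝ} (h : m ≠ 0 → 0 < a ∧ 0 < r) (hT : 0 ≤ T) :
    HasDerivAt (fun t => m * (Real.log (a + t * r) - Real.log (1 + t)))
      (m * r / (a + T * r) - m / (1 + T)) T := by
  rcases eq_or_ne m 0 with rfl | hm
  · simpa using hasDerivAt_const T (0 : ℝ)
  obtain ⟨ha, hr⟩ := h hm
  have h₁ : HasDerivAt (fun t => a + t * r) r T := by
    simpa using ((hasDerivAt_id T).mul_const r).const_add a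
  have h₂ : HasDerivAt (fun t : ℝ => 1 + t) 1 T := (hasDerivAt_id T).const_add 1
  have := ((h₁.log (by positivity)).sub (h₂.log (by positivity))).const_mul m
  exact this.congr_deriv (by ring)

lemma tendsto_mul_log_sub {m a r : ℝ} (h : m ≠ 0 → 0 < a ∧ 0 < r) :
    Filter.Tendsto (fun t => m * (Real.log (a + t * r) - Real.log (1 + t))) Filter.atTop
      (nhds (m * Real.log r)) := by
  rcases eq_or_ne m 0 with rfl | hm
  · simp
  obtain ⟨ha, hr⟩ := h hm
  have h₁ : Filter.Tendsto (fun t : ℝ => 1 + t) Filter.atTop Filter.atTop :=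
    Filter.tendsto_atTop_add_const_left _ _ Filter.tendsto_id
  have h₂ : Filter.Tendsto (fun t : ℝ => r + (a - r) * (1 + t)⁻¹) Filter.atTop (nhds r) := by
    simpa using (h₁.inv_tendsto_atTop.const_mul (a - r)).const_add r
  refine ((h₂.log hr.ne').congr' ?_).const_mul m
  filter_upwards [Filter.eventually_ge_atTop 0] with t ht
  rw [← Real.log_div (by positivity) (by positivity)]
  congr 1
  field_simp
  ring

/-- An integrated form of a comparison of resolvents: integrating over `s` turns it into a
comparison of relative entropies. -/
lemma sum_mul_log_sub_log_le {ι κ : Type*} [Fintype ι] [Fintype κ]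
    {m a r : ι → ℝ} {n q p : κ → ℝ}
    (hm : ∀ k, m k ≠ 0 → 0 < a k ∧ 0 < r k) (hn : ∀ k, n k ≠ 0 → 0 < q k ∧ 0 < p k)
    (hmn : ∑ k, m k = ∑ k, n k)
    (h : ∀ s, 0 < s → ∑ k, n k * p k / (q k + s * p k) ≤ ∑ k, m k * r k / (a k + s * r k)) :
    ∑ k, n k * (Real.log (p k) - Real.log (q k)) ≤
      ∑ k, m k * (Real.log (r k) - Real.log (a k)) := by
  set F : ℝ → ℝ := fun t => ∑ k, m k * (Real.log (a k + t * r k) - Real.log (1 + t)) -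
    ∑ k, n k * (Real.log (q k + t * p k) - Real.log (1 + t)) with hF
  have hderiv : ∀ t, 0 ≤ t → HasDerivAt F
      (∑ k, (m k * r k / (a k + t * r k) - m k / (1 + t)) -
        ∑ k, (n k * p k / (q k + t * p k) - n k / (1 + t))) t := fun t ht =>
    (HasDerivAt.fun_sum fun k _ => hasDerivAt_mul_log_sub (hm k) ht).sub
      (HasDerivAt.fun_sum fun k _ => hasDerivAt_mul_log_sub (hn k) ht)
  have hmono : MonotoneOn F (Set.Ici 0) := by
    refine monotoneOn_of_deriv_nonneg (convex_Ici 0)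
      (fun t ht => (hderiv t ht).continuousAt.continuousWithinAt) ?_ ?_
    · rw [interior_Ici]
      exact fun t ht => (hderiv t (le_of_lt ht)).differentiableAt.differentiableWithinAt
    · rw [interior_Ici]
      intro t ht
      rw [(hderiv t (le_of_lt ht)).deriv, Finset.sum_sub_distrib, Finset.sum_sub_distrib,
        ← Finset.sum_div, ← Finset.sum_div, hmn]
      linarith [h t ht]
  have hlim : Filter.Tendsto F Filter.atTop
      (nhds (∑ k, m k * Real.log (r k) - ∑ k, n k * Real.log (p k))) :=
    (tendsto_finsetSum _ fun k _ => tendsto_mul_log_sub (hm k)).sub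
      (tendsto_finsetSum _ fun k _ => tendsto_mul_log_sub (hn k))
  have hle := ge_of_tendsto hlim (Filter.eventually_atTop.2
    ⟨0, fun t ht => hmono Set.self_mem_Ici ht ht⟩)
  simp only [hF, zero_mul, add_zero, Real.log_one, sub_zero] at hle
  simp only [mul_sub, Finset.sum_sub_distrib]
  linarith

section Unitary

variable {n : Type*} [Fintype n] [DecidableEq n]

lemma mul_diagonal_mul_conjTranspose_apply_self (B : Matrix n n ℂ) (r : n → ℝ) (y : n) :
    (B * diagonal (fun j => (r j : ℂ)) * Bᴴ) y y =
      ((∑ j, Complex.normSq (B y j) * r j : ℝ) : ℂ) := by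
  rw [mul_apply]
  simp only [mul_diagonal, conjTranspose_apply]
  push_cast
  refine Finset.sum_congr rfl fun j _ => ?_
  rw [Complex.normSq_eq_conj_mul_self]
  simp only [RCLike.star_def]
  ring

lemma sum_normSq_row_s17 {B : Matrix n n ℂ} (hB : B * Bᴴ = 1) (y : n) :
    ∑ j, Complex.normSq (B y j) = 1 := by
  have := mul_diagonal_mul_conjTranspose_apply_self B (fun _ => 1) y
  simp only [Complex.ofReal_one, diagonal_one, mul_one, hB, one_apply_eq] at this
  exact_mod_cast this.symm

lemma sum_normSq_col_s17 {B : Matrix n n ℂ} (hB : B * Bᴴ = 1) (j : n) :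
    ∑ y, Complex.normSq (B y j) = 1 := by
  have := sum_normSq_row_s17 (B := Bᴴ) (by simpa using mul_eq_one_comm.1 hB) j
  simpa [conjTranspose_apply, Complex.normSq_conj] using this

lemma two_mul_re_sub_le_div {u k : ℂ} {a r s : ℝ} (ha : 0 ≤ a) (hr : 0 ≤ r) (hs : 0 < s) :
    2 * (r * (star u * k).re) - Complex.normSq k * (a + s * r) ≤
      Complex.normSq u * r * r / (a + s * r) := by
  have hsr : 0 ≤ s * r := by positivity
  rcases (add_nonneg ha hsr).eq_or_lt with h0 | hpos
  · have : r = 0 := by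
      have : s * r = 0 := by linarith
      simpa [hs.ne'] using this
    rw [← h0]
    simp [this]
  · rw [le_div_iff₀ hpos]
    simp only [Complex.normSq_apply, RCLike.star_def, Complex.mul_re, Complex.conj_re,
      Complex.conj_im]
    nlinarith [sq_nonneg (u.re * r - k.re * (a + s * r)), sq_nonneg (u.im * r - k.im * (a + s * r))]

/-- Comparison of resolvents behind the monotonicity of relative entropy under a rank-one
measurement, for a reference state with a flat outcome distribution. -/
lemma sum_div_add_le_of_unbiased {A B : Matrix n n ℂ} (hA : A * Aᴴ = 1) (hB : B * Bᴴ = 1)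
    {c : ℝ} (hc : 0 < c) (hAc : ∀ i y, Complex.normSq (A i y) = c)
    {r : n → ℝ} (hr : ∀ j, 0 ≤ r j) (hr1 : ∑ j, r j = 1) {a p : n → ℝ}
    (ha : ∀ i, a i = ∑ j, Complex.normSq ((A * B) i j) * r j)
    (hp : ∀ y, p y = ∑ j, Complex.normSq (B y j) * r j) {s : ℝ} (hs : 0 < s) :
    ∑ y, p y * p y / (c + s * p y) ≤
      ∑ i, ∑ j, Complex.normSq ((A * B) i j) * r j * r j / (a i + s * r j) := by
  have ha0 : ∀ i, 0 ≤ a i := fun i => by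
    rw [ha]; exact Finset.sum_nonneg fun j _ => mul_nonneg (Complex.normSq_nonneg _) (hr j)
  have hp0 : ∀ y, 0 ≤ p y := fun y => by
    rw [hp]; exact Finset.sum_nonneg fun j _ => mul_nonneg (Complex.normSq_nonneg _) (hr j)
  have hAB : (A * B) * (A * B)ᴴ = 1 := by
    rw [conjTranspose_mul, Matrix.mul_assoc, ← Matrix.mul_assoc B, hB, Matrix.one_mul, hA]
  have ha1 : ∑ i, a i = 1 := by
    simp only [ha]
    rw [Finset.sum_comm]
    simp [← Finset.sum_mul, sum_normSq_col_s17 hAB, hr1]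
  have hA' : Aᴴ * A = 1 := mul_eq_one_comm.1 hA
  set χ : n → ℝ := fun y => p y / (c + s * p y) with hχ
  set K : Matrix n n ℂ := A * diagonal (fun y => (χ y : ℂ)) * B with hK
  have hcross : ∀ j, ∑ i, (star ((A * B) i j) * K i j).re =
      ∑ y, Complex.normSq (B y j) * χ y := fun j => by
    have h₁ : (A * B)ᴴ * K = Bᴴ * diagonal (fun y => (χ y : ℂ)) * Bᴴᴴ := by
      rw [hK, conjTranspose_mul, conjTranspose_conjTranspose, Matrix.mul_assoc, Matrix.mul_assoc,
        ← Matrix.mul_assoc Aᴴ A, hA', Matrix.one_mul, Matrix.mul_assoc]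
    have h₂ := mul_diagonal_mul_conjTranspose_apply_self Bᴴ χ j
    rw [← h₁, mul_apply] at h₂
    have h₃ := congrArg Complex.re h₂
    rw [Complex.re_sum, Complex.ofReal_re] at h₃
    simpa [conjTranspose_apply, Complex.normSq_conj] using h₃
  have hcol : ∀ j, ∑ i, Complex.normSq (K i j) =
      ∑ y, Complex.normSq (B y j) * χ y ^ 2 := fun j => by
    have h₁ : Kᴴ * Kᴴᴴ = Bᴴ * diagonal (fun y => ((χ y ^ 2 : ℝ) : ℂ)) * Bᴴᴴ := by
      have : (diagonal (fun y => ((χ y ^ 2 : ℝ) : ℂ)) : Matrix n n ℂ) =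
          (diagonal fun y => (χ y : ℂ))ᴴ * (diagonal fun y => (χ y : ℂ)) := by
        rw [diagonal_conjTranspose, diagonal_mul_diagonal]
        congr 1
        ext y
        simp [sq]
      rw [this, hK]
      simp only [conjTranspose_mul, conjTranspose_conjTranspose, Matrix.mul_assoc]
      rw [← Matrix.mul_assoc Aᴴ A, hA', Matrix.one_mul]
    have h₂ := mul_diagonal_mul_conjTranspose_apply_self Bᴴ (fun y => χ y ^ 2) j
    have h₃ := mul_diagonal_mul_conjTranspose_apply_self Kᴴ (fun _ => 1) j
    simp only [Complex.ofReal_one, diagonal_one, Matrix.mul_one] at h₃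
    rw [h₁, h₂] at h₃
    have h₄ := Complex.ofReal_injective h₃
    simpa [conjTranspose_apply, Complex.normSq_conj] using h₄.symm
  have hrow : ∀ i, ∑ j, Complex.normSq (K i j) = c * ∑ y, χ y ^ 2 := fun i => by
    have h₁ : K * Kᴴ = A * diagonal (fun y => ((χ y ^ 2 : ℝ) : ℂ)) * Aᴴ := by
      have : (diagonal (fun y => ((χ y ^ 2 : ℝ) : ℂ)) : Matrix n n ℂ) =
          (diagonal fun y => (χ y : ℂ)) * (diagonal fun y => (χ y : ℂ))ᴴ := by
        rw [diagonal_conjTranspose, diagonal_mul_diagonal]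
        congr 1
        ext y
        simp [sq]
      rw [this, hK]
      simp only [conjTranspose_mul, Matrix.mul_assoc]
      rw [← Matrix.mul_assoc B Bᴴ, hB, Matrix.one_mul]
    have h₂ := mul_diagonal_mul_conjTranspose_apply_self A (fun y => χ y ^ 2) i
    have h₃ := mul_diagonal_mul_conjTranspose_apply_self K (fun _ => 1) i
    simp only [Complex.ofReal_one, diagonal_one, Matrix.mul_one] at h₃
    rw [h₁, h₂] at h₃
    have h₄ := Complex.ofReal_injective h₃
    simpa [hAc, Finset.mul_sum] using h₄.symm
  have hflip : ∀ f : n → ℝ, ∑ j, r j * ∑ y, Complex.normSq (B y j) * f y = ∑ y, p y * f y := by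
    intro f
    simp only [hp, Finset.mul_sum, Finset.sum_mul]
    rw [Finset.sum_comm]
    exact Finset.sum_congr rfl fun _ _ => Finset.sum_congr rfl fun _ _ => by ring
  calc ∑ y, p y * p y / (c + s * p y)
      = 2 * ∑ y, p y * χ y - (c * ∑ y, χ y ^ 2 + s * ∑ y, p y * χ y ^ 2) := by
        simp only [Finset.mul_sum, ← Finset.sum_add_distrib, ← Finset.sum_sub_distrib]
        refine Finset.sum_congr rfl fun y _ => ?_
        have : 0 < c + s * p y := by have := hp0 y; positivity
        simp only [hχ]
        field_simp
        ring
    _ = 2 * ∑ j, r j * ∑ i, (star ((A * B) i j) * K i j).re -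
          (∑ i, a i * ∑ j, Complex.normSq (K i j) +
            s * ∑ j, r j * ∑ i, Complex.normSq (K i j)) := by
        simp only [hcross, hcol, hrow, hflip, ← Finset.sum_mul, ha1, one_mul]
    _ = ∑ i, ∑ j, (2 * (r j * (star ((A * B) i j) * K i j).re) -
          Complex.normSq (K i j) * (a i + s * r j)) := by
        simp only [Finset.mul_sum, Finset.sum_sub_distrib, mul_add, Finset.sum_add_distrib]
        congr 1
        · exact Finset.sum_comm
        · congr 1
          · exact Finset.sum_congr rfl fun _ _ => Finset.sum_congr rfl fun _ _ => by ring
          · rw [Finset.sum_comm]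
            exact Finset.sum_congr rfl fun _ _ => Finset.sum_congr rfl fun _ _ => by ring
    _ ≤ _ := Finset.sum_le_sum fun i _ => Finset.sum_le_sum fun j _ =>
        two_mul_re_sub_le_div (ha0 i) (hr j) hs

/-- The entropic uncertainty relation with the entropy of the state, in coordinates: `r` is the
spectrum of the state, `B` and `A * B` express its eigenbasis in the two measured bases. -/
lemma neg_log_add_sum_negMulLog_le_of_unbiased {A B : Matrix n n ℂ}
    (hA : A * Aᴴ = 1) (hB : B * Bᴴ = 1)
    {c : ℝ} (hc : 0 < c) (hAc : ∀ i y, Complex.normSq (A i y) = c)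
    {r : n → ℝ} (hr : ∀ j, 0 ≤ r j) (hr1 : ∑ j, r j = 1) :
    -Real.log c + ∑ j, Real.negMulLog (r j) ≤
      ∑ i, Real.negMulLog (∑ j, Complex.normSq ((A * B) i j) * r j) +
        ∑ y, Real.negMulLog (∑ j, Complex.normSq (B y j) * r j) := by
  set a : n → ℝ := fun i => ∑ j, Complex.normSq ((A * B) i j) * r j with ha
  set p : n → ℝ := fun y => ∑ j, Complex.normSq (B y j) * r j with hp
  have hnn : ∀ (M : Matrix n n ℂ) i j, 0 ≤ Complex.normSq (M i j) * r j := fun M i j =>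
    mul_nonneg (Complex.normSq_nonneg _) (hr j)
  have hAB : (A * B) * (A * B)ᴴ = 1 := by
    rw [conjTranspose_mul, Matrix.mul_assoc, ← Matrix.mul_assoc B, hB, Matrix.one_mul, hA]
  have hp1 : ∑ y, p y = 1 := by
    simp only [hp]
    rw [Finset.sum_comm]
    simp [← Finset.sum_mul, sum_normSq_col_s17 hB, hr1]
  have hm1 : ∑ k : n × n, Complex.normSq ((A * B) k.1 k.2) * r k.2 = 1 := by
    rw [Fintype.sum_prod_type, Finset.sum_comm]
    simp [← Finset.sum_mul, sum_normSq_col_s17 hAB, hr1]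
  have key := sum_mul_log_sub_log_le
    (m := fun k : n × n => Complex.normSq ((A * B) k.1 k.2) * r k.2)
    (a := fun k => a k.1) (r := fun k => r k.2) (n := p) (q := fun _ => c) (p := p)
    (fun k hk => ⟨((hnn (A * B) k.1 k.2).lt_of_ne' hk).trans_le
        (Finset.single_le_sum (fun j _ => hnn (A * B) k.1 j) (Finset.mem_univ k.2)),
      (hr k.2).lt_of_ne' (right_ne_zero_of_mul hk)⟩)
    (fun y hy => ⟨hc, (Finset.sum_nonneg fun j _ => hnn B y j).lt_of_ne' hy⟩)
    (hm1.trans hp1.symm)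
    (fun s hs => by
      rw [Fintype.sum_prod_type]
      exact sum_div_add_le_of_unbiased hA hB hc hAc hr hr1 (fun _ => rfl) (fun _ => rfl) hs)
  have hlhs : ∑ y, p y * (Real.log (p y) - Real.log c) =
      -∑ y, Real.negMulLog (p y) - Real.log c := by
    simp only [mul_sub, Finset.sum_sub_distrib, ← Finset.sum_mul, hp1, Real.negMulLog]
    simp
  have hrhs : ∑ k : n × n, Complex.normSq ((A * B) k.1 k.2) * r k.2 *
      (Real.log (r k.2) - Real.log (a k.1)) =
      -∑ j, Real.negMulLog (r j) + ∑ i, Real.negMulLog (a i) := by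
    simp only [mul_sub, Finset.sum_sub_distrib, Fintype.sum_prod_type]
    rw [Finset.sum_comm]
    simp only [← Finset.sum_mul, sum_normSq_col_s17 hAB, Real.negMulLog]
    simp [ha, Finset.sum_neg_distrib, sub_eq_add_neg]
  rw [hlhs, hrhs] at key
  linarith

lemma vnEnt_eq_sum_negMulLog {A : Matrix n n ℂ} (hA : A.IsHermitian) :
    vnEnt A = ∑ i, Real.negMulLog (hA.eigenvalues i) := by
  set U : Matrix n n ℂ := (hA.eigenvectorUnitary : Matrix n n ℂ) with hU
  have hUU : star U * U = 1 := Unitary.coe_star_mul_self hA.eigenvectorUnitary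
  have hspec : A = U * diagonal (fun i => (hA.eigenvalues i : ℂ)) * star U := by
    conv_lhs => rw [hA.spectral_theorem]
    rfl
  have hmul : A * mlog A = U * (diagonal (fun i => (hA.eigenvalues i : ℂ)) *
      diagonal (fun i => ((Real.log (hA.eigenvalues i) : ℝ) : ℂ))) * star U := by
    rw [mlog, dif_pos hA, ← hU]
    conv_lhs => enter [1]; rw [hspec]
    simp only [Matrix.mul_assoc]
    rw [← Matrix.mul_assoc (star U) U, hUU, Matrix.one_mul]
  rw [vnEnt, hmul, Matrix.trace_mul_comm, ← Matrix.mul_assoc, hUU, Matrix.one_mul,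
    diagonal_mul_diagonal, trace_diagonal, Complex.re_sum, ← Finset.sum_neg_distrib]
  refine Finset.sum_congr rfl fun i _ => ?_
  rw [← Complex.ofReal_mul, Complex.ofReal_re, Real.negMulLog, neg_mul]

lemma vnEnt_conj_diagonal {V : Matrix n n ℂ} (hV : V * Vᴴ = 1) (p : n → ℝ) :
    vnEnt (Vᴴ * diagonal (fun i => (p i : ℂ)) * V) = ∑ i, Real.negMulLog (p i) := by
  have hH : (Vᴴ * diagonal (fun i => (p i : ℂ)) * V).IsHermitian := by
    refine isHermitian_conjTranspose_mul_mul V ?_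
    exact isHermitian_diagonal_of_self_adjoint _ (by ext i; simp)
  have hroots := hH.roots_charpoly_eq_eigenvalues
  rw [charpoly_mul_comm, ← Matrix.mul_assoc, hV, Matrix.one_mul, charpoly_diagonal,
    Polynomial.roots_prod _ _ (by simp [Finset.prod_ne_zero_iff, Polynomial.X_sub_C_ne_zero])]
    at hroots
  have := congrArg (fun M => (M.map fun z : ℂ => Real.negMulLog z.re).sum) hroots
  simp only [Polynomial.roots_X_sub_C, Multiset.bind_singleton, Multiset.map_map] at this
  rw [vnEnt_eq_sum_negMulLog hH]
  exact this.symm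

lemma probOf_vecMulVec (ρ : Matrix n n ℂ) (v : n → n → ℂ) (x : n) :
    probOf ρ (fun x => vecMulVec (v x) (star (v x))) x =
      (((of fun x => star (v x)) * ρ * (of fun x => star (v x))ᴴ : Matrix n n ℂ) x x).re := by
  rw [probOf, mul_vecMulVec, trace_vecMulVec, Matrix.mul_assoc, mul_apply]
  simp [dotProduct, mulVec, mul_apply, conjTranspose_apply, mul_comm]

lemma pinch_vecMulVec {ρ : Matrix n n ℂ} (hρ : ρ.IsHermitian) (v : n → n → ℂ) :
    pinch (fun x => vecMulVec (v x) (star (v x))) ρ =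
      (of fun x => star (v x))ᴴ *
        diagonal (fun x => ((probOf ρ (fun x => vecMulVec (v x) (star (v x))) x : ℝ) : ℂ)) *
        (of fun x => star (v x)) := by
  set V : Matrix n n ℂ := of fun x => star (v x) with hV
  have hp : ∀ x, ((probOf ρ (fun x => vecMulVec (v x) (star (v x))) x : ℝ) : ℂ) =
      star (v x) ⬝ᵥ ρ *ᵥ v x := fun x => by
    have h₁ : (V * ρ * Vᴴ) x x = star (v x) ⬝ᵥ ρ *ᵥ v x := by
      rw [Matrix.mul_assoc, mul_apply]
      simp [hV, dotProduct, mulVec, mul_apply, conjTranspose_apply]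
    rw [probOf_vecMulVec, ← hV, ← h₁]
    exact (isHermitian_mul_mul_conjTranspose V hρ).coe_re_apply_self x
  ext i j
  rw [pinch, Matrix.sum_apply, mul_apply]
  refine Finset.sum_congr rfl fun x _ => ?_
  rw [mul_diagonal, hp, vecMulVec_mul, vecMulVec_mul_vecMulVec, ← dotProduct_mulVec]
  simp [hV, vecMulVec_apply, conjTranspose_apply]
  ring

end Unitary

/-- For two mutually unbiased orthonormal bases of `ℂ^d` with associated
rank-1 projective observables `X`, `Y`: (i) `Q_1(X|ρ) + H(Y|ρ) ≥ log d` where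
`Q_1(X|ρ) = H(ρ_X) - H(ρ)`, and (ii) `H(X|ρ) + H(Y|ρ) ≥ log d + H(ρ)`. -/
theorem mub_asymmetry_entropy_tradeoff
    {d : ℕ} (v w : Fin d → (Fin d → ℂ))
    (hv : ∀ x x', star (v x) ⬝ᵥ v x' = if x = x' then 1 else 0)
    (hw : ∀ y y', star (w y) ⬝ᵥ w y' = if y = y' then 1 else 0)
    (hmub : ∀ x y, Complex.normSq (star (v x) ⬝ᵥ w y) = 1 / d)
    (ρ : Matrix (Fin d) (Fin d) ℂ) (hρ : IsDensity ρ) :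
    (Real.log d ≤
      (vnEnt (pinch (fun x => vecMulVec (v x) (star (v x))) ρ) - vnEnt ρ)
        + ∑ y, Real.negMulLog (probOf ρ (fun y => vecMulVec (w y) (star (w y))) y)) ∧
    (Real.log d + vnEnt ρ ≤
      (∑ x, Real.negMulLog (probOf ρ (fun x => vecMulVec (v x) (star (v x))) x))
        + ∑ y, Real.negMulLog (probOf ρ (fun y => vecMulVec (w y) (star (w y))) y)) := by
  have hρH : ρ.IsHermitian := hρ.1.1
  set V : Matrix (Fin d) (Fin d) ℂ := of fun x => star (v x) with hVdef
  set W : Matrix (Fin d) (Fin d) ℂ := of fun y => star (w y) with hWdef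
  have hVV : V * Vᴴ = 1 := by
    ext x x'
    rw [one_apply, ← hv x x', mul_apply]
    simp [hVdef, dotProduct, conjTranspose_apply]
  have hWW : W * Wᴴ = 1 := by
    ext y y'
    rw [one_apply, ← hw y y', mul_apply]
    simp [hWdef, dotProduct, conjTranspose_apply]
  have hWW' : Wᴴ * W = 1 := mul_eq_one_comm.1 hWW
  have hVV' : Vᴴ * V = 1 := mul_eq_one_comm.1 hVV
  set E : Matrix (Fin d) (Fin d) ℂ := (hρH.eigenvectorUnitary : Matrix (Fin d) (Fin d) ℂ) with hE
  have hEE : E * Eᴴ = 1 := Unitary.coe_mul_star_self hρH.eigenvectorUnitary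
  have hspec : ρ = E * diagonal (fun i => (hρH.eigenvalues i : ℂ)) * Eᴴ := by
    conv_lhs => rw [hρH.spectral_theorem]
    rfl
  have hprob : ∀ (u : Fin d → Fin d → ℂ) x,
      probOf ρ (fun x => vecMulVec (u x) (star (u x))) x =
        ∑ j, Complex.normSq (((of fun x => star (u x)) * E) x j) * hρH.eigenvalues j := by
    intro u x
    set M : Matrix (Fin d) (Fin d) ℂ := of fun x => star (u x)
    have h₁ : M * ρ * Mᴴ =
        (M * E) * diagonal (fun i => (hρH.eigenvalues i : ℂ)) * (M * E)ᴴ := by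
      conv_lhs => rw [hspec]
      simp only [conjTranspose_mul, Matrix.mul_assoc]
    rw [probOf_vecMulVec, h₁, mul_diagonal_mul_conjTranspose_apply_self, Complex.ofReal_re]
  have htr : ∑ j, hρH.eigenvalues j = 1 := by
    have := hρH.trace_eq_sum_eigenvalues
    rw [hρ.2] at this
    simpa using (congrArg Complex.re this).symm
  have hd : 0 < d := by
    rcases Nat.eq_zero_or_pos d with rfl | h
    · simp at htr
    · exact h
  have hA : (V * Wᴴ) * (V * Wᴴ)ᴴ = 1 := by
    rw [conjTranspose_mul, conjTranspose_conjTranspose, Matrix.mul_assoc, ← Matrix.mul_assoc Wᴴ,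
      hWW', Matrix.one_mul, hVV]
  have hB : (W * E) * (W * E)ᴴ = 1 := by
    rw [conjTranspose_mul, Matrix.mul_assoc, ← Matrix.mul_assoc E, hEE, Matrix.one_mul, hWW]
  have hAB : (V * Wᴴ) * (W * E) = V * E := by
    rw [Matrix.mul_assoc, ← Matrix.mul_assoc Wᴴ, hWW', Matrix.one_mul]
  have hAc : ∀ x y, Complex.normSq ((V * Wᴴ) x y) = 1 / d := fun x y => by
    rw [← hmub x y, mul_apply]
    simp [hVdef, hWdef, dotProduct, conjTranspose_apply]
  have key := neg_log_add_sum_negMulLog_le_of_unbiased hA hB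
    (one_div_pos.2 (Nat.cast_pos.2 hd)) hAc
    (fun j => hρ.1.eigenvalues_nonneg j) htr
  rw [hAB, one_div, Real.log_inv, neg_neg, ← vnEnt_eq_sum_negMulLog hρH] at key
  simp only [hVdef, hWdef, ← hprob] at key
  rw [pinch_vecMulVec hρH, vnEnt_conj_diagonal hVV]
  exact ⟨by linarith, key⟩

end QC
end
end
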